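/- arXiv:1801.01860 — 3 statements merged into one kernel-verified Lean document; each statement's English description precedes it below -/
import Mathlib

section
/- Let T > 0, let s, n be natural numbers, and let h be a smooth real function with supp h ⊆ (0, T/3] ∪ [2T/3, T) and ∫₀^T t^k h(t) dt = 0 for every integer 0 ≤ k < n. Let V : [0,∞) × [0,∞) → ℝ be a bounded continuous function, smooth on (0,∞) × [0,∞), satisfying ∂_t V = ∂_{zz} V for t > 0 and z > 0, V(t,0) = h(t) for all t ≥ 0, and V(0,z) = 0 for all z ≥ 0; assume moreover that for each 0 ≤ m ≤ 2n+1 the map t ↦ |V(t,·)|_{H^{s,m}(ℝ₊)} is finite and locally bounded. Then for every integer m with 0 ≤ m ≤ 2n+1 there exists a constant C > 0 such that for all t ≥ 0: |V(t,·)|_{H^{s,m}(ℝ₊)} ≤ C · (ln(2+t)/(2+t))^{1/4 + (2n+1)/2 − m/2}. -/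
open MeasureTheory Set Finset

/-- The weighted Sobolev norm `|g|_{H^{s,m}(ℝ₊)}` of the paper:
`(Σ_{α=0}^{s} ∫₀^∞ (1+z²)^m |g^{(α)}(z)|² dz)^{1/2}`. -/
noncomputable def weightedSobolevNorm (s m : ℕ) (g : ℝ → ℝ) : ℝ :=
  Real.sqrt (∑ α ∈ Finset.range (s + 1),
    ∫ z in Set.Ioi (0:ℝ), (1 + z ^ 2) ^ m * (iteratedDeriv α g z) ^ 2)


open Filter Topology

/-- The `j`-th derivative of the Gaussian `exp (-y²/2)`. -/
noncomputable def gaussDeriv (j : ℕ) : ℝ → ℝ :=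
  iteratedDeriv j (fun y : ℝ => Real.exp (-(y ^ 2 / 2)))

lemma hasDerivAt_gaussDeriv (j : ℕ) (y : ℝ) :
    HasDerivAt (gaussDeriv j) (gaussDeriv (j + 1) y) y := by
  have hc : ContDiff ℝ (⊤ : ℕ∞) (fun y : ℝ => Real.exp (-(y ^ 2 / 2))) := by fun_prop
  have hd := hc.differentiable_iteratedDeriv j (by exact_mod_cast WithTop.coe_lt_top j)
  rw [gaussDeriv, gaussDeriv, iteratedDeriv_succ]
  exact (hd y).hasDerivAt

lemma gaussDeriv_zero (y : ℝ) : gaussDeriv 0 y = Real.exp (-(y ^ 2 / 2)) := by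
  simp [gaussDeriv]

lemma gaussDeriv_one (y : ℝ) : gaussDeriv 1 y = -(y * gaussDeriv 0 y) := by
  have h1 := hasDerivAt_gaussDeriv 0 y
  have h2 : HasDerivAt (fun y : ℝ => Real.exp (-(y ^ 2 / 2)))
      (Real.exp (-(y ^ 2 / 2)) * (-(((2 : ℕ) : ℝ) * y ^ (2 - 1) * 1 / 2))) y :=
    (((((hasDerivAt_id y).pow 2)).div_const 2).neg).exp
  have h3 : gaussDeriv 0 = fun y : ℝ => Real.exp (-(y ^ 2 / 2)) := funext gaussDeriv_zero
  rw [h3] at h1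
  rw [h1.unique h2, gaussDeriv_zero]
  push_cast
  ring

lemma gaussDeriv_add_two (j : ℕ) (y : ℝ) :
    gaussDeriv (j + 2) y = -(y * gaussDeriv (j + 1) y + (j + 1) * gaussDeriv j y) := by
  induction j generalizing y with
  | zero =>
    have h1 := hasDerivAt_gaussDeriv 1 y
    rw [show gaussDeriv 1 = fun y => -(y * gaussDeriv 0 y) from funext gaussDeriv_one] at h1
    have h2 := ((hasDerivAt_id y).mul (hasDerivAt_gaussDeriv 0 y)).neg
    rw [h1.unique h2]
    simp
    ring
  | succ j ih =>
    have h1 := hasDerivAt_gaussDeriv (j + 2) y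
    rw [show gaussDeriv (j + 2) = _ from funext ih] at h1
    have h2 := (((hasDerivAt_id y).mul (hasDerivAt_gaussDeriv (j + 1) y)).add
      ((hasDerivAt_gaussDeriv j y).const_mul ((j : ℝ) + 1))).neg
    rw [h1.unique h2]
    simp
    ring

lemma exists_pow_mul_exp_le (k : ℕ) (b : ℝ) (hb : 0 < b) :
    ∃ C, 0 ≤ C ∧ ∀ y : ℝ, |y| ^ k * Real.exp (-(b * y ^ 2)) ≤ C := by
  refine ⟨1 + k.factorial / b ^ k, by positivity, fun y => ?_⟩
  have h1 : (b * y ^ 2) ^ k / k.factorial ≤ Real.exp (b * y ^ 2) :=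
    Real.pow_div_factorial_le_exp _ (by positivity) k
  have h2 : |y| ^ k ≤ 1 + (y ^ 2) ^ k := by
    rw [← sq_abs, ← pow_mul, mul_comm, pow_mul]
    nlinarith [sq_nonneg (|y| ^ k - 1)]
  have h3 : (y ^ 2) ^ k ≤ k.factorial / b ^ k * Real.exp (b * y ^ 2) := by
    rw [mul_pow, div_le_iff₀ (by positivity)] at h1
    rw [div_mul_eq_mul_div, le_div_iff₀ (by positivity)]
    linarith
  have h4 : 1 ≤ Real.exp (b * y ^ 2) := Real.one_le_exp (by positivity)
  rw [Real.exp_neg, ← div_eq_mul_inv, div_le_iff₀ (Real.exp_pos _)]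
  linarith

lemma exists_pow_mul_abs_gaussDeriv_le (j : ℕ) :
    ∀ k : ℕ, ∃ C, 0 ≤ C ∧ ∀ y : ℝ, |y| ^ k * |gaussDeriv j y| ≤ C * Real.exp (-(y ^ 2 / 4)) := by
  have h0 : ∀ k : ℕ, ∃ C, 0 ≤ C ∧
      ∀ y : ℝ, |y| ^ k * |gaussDeriv 0 y| ≤ C * Real.exp (-(y ^ 2 / 4)) := by
    intro k
    obtain ⟨C, hC, h⟩ := exists_pow_mul_exp_le k (1 / 4) (by norm_num)
    refine ⟨C, hC, fun y => ?_⟩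
    have he : |gaussDeriv 0 y| = Real.exp (-(1 / 4 * y ^ 2)) * Real.exp (-(y ^ 2 / 4)) := by
      rw [gaussDeriv_zero, abs_of_pos (Real.exp_pos _), ← Real.exp_add]
      congr 1
      ring
    rw [he, ← mul_assoc]
    exact mul_le_mul_of_nonneg_right (h y) (Real.exp_pos _).le
  induction j using Nat.twoStepInduction with
  | zero => exact h0
  | one =>
    intro k
    obtain ⟨C, hC, h⟩ := h0 (k + 1)
    refine ⟨C, hC, fun y => ?_⟩
    rw [gaussDeriv_one, abs_neg, abs_mul, ← mul_assoc, ← pow_succ]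
    exact h y
  | more j ih1 ih2 =>
    intro k
    obtain ⟨C, hC, h⟩ := ih2 (k + 1)
    obtain ⟨C', hC', h'⟩ := ih1 k
    refine ⟨C + (j + 1) * C', by positivity, fun y => ?_⟩
    have hab : |gaussDeriv (j + 2) y| ≤ |y| * |gaussDeriv (j + 1) y| + (j + 1) * |gaussDeriv j y| := by
      rw [gaussDeriv_add_two, abs_neg]
      refine (abs_add_le _ _).trans_eq ?_
      rw [abs_mul, abs_mul, abs_of_nonneg (by positivity : (0 : ℝ) ≤ j + 1)]
    calc |y| ^ k * |gaussDeriv (j + 2) y|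
        ≤ |y| ^ k * (|y| * |gaussDeriv (j + 1) y| + (j + 1) * |gaussDeriv j y|) := by gcongr
      _ = |y| ^ (k + 1) * |gaussDeriv (j + 1) y| + (j + 1) * (|y| ^ k * |gaussDeriv j y|) := by ring
      _ ≤ C * Real.exp (-(y ^ 2 / 4)) + (j + 1) * (C' * Real.exp (-(y ^ 2 / 4))) :=
          add_le_add (h y) (mul_le_mul_of_nonneg_left (h' y) (by positivity))
      _ = _ := by ring

/-- The parabolic scale `(2t)^{-1/2}`. -/
noncomputable def heatScale (t : ℝ) : ℝ := (Real.sqrt (2 * t))⁻¹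

lemma heatScale_pos {t : ℝ} (ht : 0 < t) : 0 < heatScale t := by
  unfold heatScale
  positivity

lemma heatScale_sq {t : ℝ} (ht : 0 < t) : heatScale t ^ 2 = 1 / (2 * t) := by
  rw [heatScale, inv_pow, Real.sq_sqrt (by positivity), one_div]

lemma hasDerivAt_heatScale {t : ℝ} (ht : 0 < t) :
    HasDerivAt heatScale (-heatScale t ^ 3) t := by
  have hs : 0 < Real.sqrt (2 * t) := by positivity
  have h1 : HasDerivAt (fun t : ℝ => 2 * t) 2 t := by simpa using (hasDerivAt_id t).const_mul 2
  have h2 := (h1.sqrt (by positivity)).inv hs.ne'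
  refine h2.congr_deriv ?_
  rw [heatScale]
  field_simp

/-- The `j`-th space derivative of the (unnormalised) heat kernel. -/
noncomputable def heatKer (j : ℕ) (t z : ℝ) : ℝ :=
  heatScale t ^ (j + 1) * gaussDeriv j (z * heatScale t)

lemma hasDerivAt_heatKer_space (j : ℕ) (t z : ℝ) :
    HasDerivAt (fun z => heatKer j t z) (heatKer (j + 1) t z) z := by
  have h1 : HasDerivAt (fun z => z * heatScale t) (heatScale t) z := by
    simpa using (hasDerivAt_id z).mul_const (heatScale t)
  have h2 := ((hasDerivAt_gaussDeriv j (z * heatScale t)).comp z h1).const_mul (heatScale t ^ (j + 1))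
  refine h2.congr_deriv ?_
  rw [heatKer]
  ring

lemma hasDerivAt_heatKer_time (j : ℕ) {t : ℝ} (ht : 0 < t) (z : ℝ) :
    HasDerivAt (fun t => heatKer j t z) (heatKer (j + 2) t z) t := by
  have h1 := hasDerivAt_heatScale ht
  have h2 := (h1.pow (j + 1)).mul
    ((hasDerivAt_gaussDeriv j (z * heatScale t)).comp t (h1.const_mul z))
  refine h2.congr_deriv ?_
  rw [heatKer, gaussDeriv_add_two]
  simp
  ring

lemma continuousOn_heatKer (j : ℕ) (z : ℝ) :
    ContinuousOn (fun t => heatKer j t z) (Set.Ioi 0) :=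
  fun _ ht => (hasDerivAt_heatKer_time j ht z).continuousAt.continuousWithinAt

lemma exists_abs_heatKer_le (j k : ℕ) : ∃ C, 0 ≤ C ∧ ∀ t > (0 : ℝ), ∀ z > (0 : ℝ),
    z ^ k * heatScale t ^ k * |heatKer j t z| ≤
      C * heatScale t ^ (j + 1) * Real.exp (-(z ^ 2 / (8 * t))) := by
  obtain ⟨C, hC, h⟩ := exists_pow_mul_abs_gaussDeriv_le j k
  refine ⟨C, hC, fun t ht z hz => ?_⟩
  have hs := heatScale_pos ht
  have h1 := h (z * heatScale t)
  rw [abs_of_pos (by positivity), mul_pow, mul_pow, heatScale_sq ht] at h1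
  rw [heatKer, abs_mul, abs_of_pos (by positivity : 0 < heatScale t ^ (j + 1))]
  have h2 : -(z ^ 2 * (1 / (2 * t)) / 4) = -(z ^ 2 / (8 * t)) := by field_simp; norm_num
  rw [h2] at h1
  calc _ = heatScale t ^ (j + 1) * (z ^ k * heatScale t ^ k * |gaussDeriv j (z * heatScale t)|) := by
        ring
    _ ≤ heatScale t ^ (j + 1) * (C * Real.exp (-(z ^ 2 / (8 * t)))) := by gcongr
    _ = _ := by ring

lemma exists_abs_heatKer_le_inv_pow (j : ℕ) : ∃ C, 0 ≤ C ∧ ∀ t > (0 : ℝ), ∀ z > (0 : ℝ),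
    |heatKer j t z| ≤ C * (z ^ (j + 1))⁻¹ := by
  obtain ⟨C, hC, h⟩ := exists_abs_heatKer_le j (j + 1)
  refine ⟨C, hC, fun t ht z hz => ?_⟩
  have hs := heatScale_pos ht
  have h1 := h t ht z hz
  have h2 : Real.exp (-(z ^ 2 / (8 * t))) ≤ 1 := Real.exp_le_one_iff.2 (by
    have : 0 ≤ z ^ 2 / (8 * t) := by positivity
    linarith)
  rw [← div_eq_mul_inv, le_div_iff₀ (by positivity)]
  have h3 : heatScale t ^ (j + 1) * (|heatKer j t z| * z ^ (j + 1)) ≤ heatScale t ^ (j + 1) * C := by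
    calc _ = z ^ (j + 1) * heatScale t ^ (j + 1) * |heatKer j t z| := by ring
      _ ≤ C * heatScale t ^ (j + 1) * Real.exp (-(z ^ 2 / (8 * t))) := h1
      _ ≤ C * heatScale t ^ (j + 1) * 1 := by gcongr
      _ = _ := by ring
  exact le_of_mul_le_mul_left h3 (by positivity)

lemma tendsto_heatKer_zero (j : ℕ) {z : ℝ} (hz : 0 < z) :
    Tendsto (fun t => heatKer j t z) (𝓝[>] 0) (𝓝 0) := by
  obtain ⟨C, hC, h⟩ := exists_abs_heatKer_le j (j + 2)
  have hlim : Tendsto (fun t : ℝ => C * (z ^ (j + 2))⁻¹ * Real.sqrt (2 * t)) (𝓝[>] 0) (𝓝 0) := by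
    have hc : Continuous (fun t : ℝ => C * (z ^ (j + 2))⁻¹ * Real.sqrt (2 * t)) := by fun_prop
    simpa using (hc.tendsto 0).mono_left nhdsWithin_le_nhds
  refine squeeze_zero_norm' ?_ hlim
  filter_upwards [self_mem_nhdsWithin] with t ht
  have ht : 0 < t := ht
  have hs := heatScale_pos ht
  have h1 := h t ht z hz
  have h2 : Real.exp (-(z ^ 2 / (8 * t))) ≤ 1 := Real.exp_le_one_iff.2 (by
    have : 0 ≤ z ^ 2 / (8 * t) := by positivity
    linarith)
  have h3 : Real.sqrt (2 * t) = (heatScale t)⁻¹ := by rw [heatScale, inv_inv]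
  rw [Real.norm_eq_abs, h3, mul_assoc, ← mul_inv, ← div_eq_mul_inv, le_div_iff₀ (by positivity)]
  have h4 : heatScale t ^ (j + 1) * (|heatKer j t z| * (z ^ (j + 2) * heatScale t)) ≤
      heatScale t ^ (j + 1) * C := by
    calc _ = z ^ (j + 2) * heatScale t ^ (j + 2) * |heatKer j t z| := by ring
      _ ≤ C * heatScale t ^ (j + 1) * Real.exp (-(z ^ 2 / (8 * t))) := h1
      _ ≤ C * heatScale t ^ (j + 1) * 1 := by gcongr
      _ = _ := by ring
  exact le_of_mul_le_mul_left h4 (by positivity)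

lemma hasCompactSupport_of_eq_zero {T : ℝ} {f : ℝ → ℝ} (h0 : ∀ x ≤ 0, f x = 0)
    (hT : ∀ x, T ≤ x → f x = 0) : HasCompactSupport f :=
  HasCompactSupport.intro (isCompact_Icc (a := 0) (b := T)) fun x hx => by
    by_contra hne
    exact hx ⟨le_of_not_ge fun h => hne (h0 x h), le_of_not_ge fun h => hne (hT x h)⟩

/-- The potential `∫₀^∞ f (t - s) (∂_z^j Γ)(s, z) ds` of a boundary density `f`. -/
noncomputable def heatPotential (f : ℝ → ℝ) (j : ℕ) (t z : ℝ) : ℝ :=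
  ∫ s in Set.Ioi (0 : ℝ), f (t - s) * heatKer j s z

section Potential

variable {f f' : ℝ → ℝ}

lemma integrableOn_heatPotential (hf : Continuous f) (hc : HasCompactSupport f) (j : ℕ) (t : ℝ)
    {z : ℝ} (hz : 0 < z) :
    IntegrableOn (fun s => f (t - s) * heatKer j s z) (Set.Ioi 0) := by
  obtain ⟨C, -, h⟩ := exists_abs_heatKer_le_inv_pow j
  refine Integrable.mul_bdd (c := C * (z ^ (j + 1))⁻¹)
    ((hf.integrable_of_hasCompactSupport hc).comp_sub_left t).integrableOn
    ((continuousOn_heatKer j z).aestronglyMeasurable measurableSet_Ioi) ?_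
  filter_upwards [ae_restrict_mem measurableSet_Ioi] with s hs
  exact h s hs z hz

lemma hasDerivAt_heatPotential_space (hf : Continuous f) (hc : HasCompactSupport f) (j : ℕ) (t : ℝ)
    {z : ℝ} (hz : 0 < z) :
    HasDerivAt (heatPotential f j t) (heatPotential f (j + 1) t z) z := by
  obtain ⟨C, hC, h⟩ := exists_abs_heatKer_le_inv_pow (j + 1)
  have hnhds : Set.Ioi (z / 2) ∈ 𝓝 z := Ioi_mem_nhds (by linarith)
  have hpos : ∀ w ∈ Set.Ioi (z / 2), 0 < w := fun w hw => lt_trans (by positivity) hw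
  refine (hasDerivAt_integral_of_dominated_loc_of_deriv_le
    (F := fun z s => f (t - s) * heatKer j s z) (F' := fun z s => f (t - s) * heatKer (j + 1) s z)
    (bound := fun s => ‖f (t - s)‖ * (C * ((z / 2) ^ (j + 1 + 1))⁻¹)) hnhds ?_
    (integrableOn_heatPotential hf hc j t hz)
    (integrableOn_heatPotential hf hc (j + 1) t hz).aestronglyMeasurable ?_ ?_ ?_).2
  · filter_upwards [hnhds] with w hw
    exact (integrableOn_heatPotential hf hc j t (hpos w hw)).aestronglyMeasurable
  · filter_upwards [ae_restrict_mem measurableSet_Ioi] with s hs w hw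
    rw [norm_mul]
    refine mul_le_mul_of_nonneg_left ((h s hs w (hpos w hw)).trans ?_) (norm_nonneg _)
    have hw' : z / 2 ≤ w := le_of_lt hw
    gcongr
  · exact ((((hf.integrable_of_hasCompactSupport hc).comp_sub_left t).norm).mul_const _).integrableOn
  · exact ae_of_all _ fun s w _ => (hasDerivAt_heatKer_space j s w).const_mul _

lemma hasDerivAt_heatPotential_time (hf : ∀ x, HasDerivAt f (f' x) x) (hf' : Continuous f')
    (hc : HasCompactSupport f) (hc' : HasCompactSupport f') (h0' : ∀ x ≤ 0, f' x = 0)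
    (j : ℕ) (t : ℝ) {z : ℝ} (hz : 0 < z) :
    HasDerivAt (fun t => heatPotential f j t z) (heatPotential f' j t z) t := by
  have hfc : Continuous f := continuous_iff_continuousAt.2 fun x => (hf x).continuousAt
  obtain ⟨C, hC, h⟩ := exists_abs_heatKer_le_inv_pow j
  obtain ⟨B, hB⟩ := hf'.bounded_above_of_compact_support hc'
  have hB0 : 0 ≤ B := (norm_nonneg _).trans (hB 0)
  have hnhds : Set.Iio (t + 1) ∈ 𝓝 t := Iio_mem_nhds (by linarith)
  refine (hasDerivAt_integral_of_dominated_loc_of_deriv_le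
    (F := fun t s => f (t - s) * heatKer j s z) (F' := fun t s => f' (t - s) * heatKer j s z)
    (bound := (Set.Ioc 0 (t + 1)).indicator fun _ => B * (C * (z ^ (j + 1))⁻¹)) hnhds
    (Eventually.of_forall fun t => (integrableOn_heatPotential hfc hc j t hz).aestronglyMeasurable)
    (integrableOn_heatPotential hfc hc j t hz)
    (integrableOn_heatPotential hf' hc' j t hz).aestronglyMeasurable ?_ ?_ ?_).2
  · filter_upwards [ae_restrict_mem measurableSet_Ioi] with s hs w hw
    have hs : 0 < s := hs
    have hw : w < t + 1 := hw
    by_cases hst : s ≤ t + 1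
    · rw [Set.indicator_of_mem (show s ∈ Set.Ioc 0 (t + 1) from ⟨hs, hst⟩), norm_mul]
      exact mul_le_mul (hB _) (h s hs z hz) (norm_nonneg _) hB0
    · rw [h0' _ (by linarith), zero_mul, norm_zero]
      exact Set.indicator_nonneg (fun _ _ => by positivity) _
  · refine Integrable.integrableOn ?_
    rw [integrable_indicator_iff measurableSet_Ioc]
    exact integrableOn_const (by simp)
  · refine ae_of_all _ fun s w _ => ?_
    have h1 : HasDerivAt (fun w => f (w - s)) (f' (w - s)) w := (hf (w - s)).comp_sub_const w s
    exact h1.mul_const _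

lemma heatPotential_deriv (hf : ∀ x, HasDerivAt f (f' x) x) (hf' : Continuous f')
    (hc : HasCompactSupport f) (hc' : HasCompactSupport f') (h0 : ∀ x ≤ 0, f x = 0)
    (j : ℕ) (t : ℝ) {z : ℝ} (hz : 0 < z) :
    heatPotential f' j t z = heatPotential f (j + 2) t z := by
  have hfc : Continuous f := continuous_iff_continuousAt.2 fun x => (hf x).continuousAt
  obtain ⟨B, hB⟩ := hfc.bounded_above_of_compact_support hc
  have h1 := integral_Ioi_mul_deriv_eq_deriv_mul (a := 0) (a' := 0) (b' := 0)
    (u := fun s => f (t - s)) (u' := fun s => -f' (t - s))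
    (v := fun s => heatKer j s z) (v' := fun s => heatKer (j + 2) s z)
    (fun s _ => (hf (t - s)).comp_const_sub t s)
    (fun s hs => hasDerivAt_heatKer_time j hs z)
    (integrableOn_heatPotential hfc hc (j + 2) t hz)
    (by
      have := (integrableOn_heatPotential hf' hc' j t hz).neg
      refine this.congr_fun (fun s _ => ?_) measurableSet_Ioi
      simp) ?_ ?_
  · rw [heatPotential, heatPotential, h1]
    simp [integral_neg]
  · have h2 := (tendsto_heatKer_zero j hz).norm.const_mul B
    rw [norm_zero, mul_zero] at h2
    refine squeeze_zero_norm (fun s => ?_) h2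
    rw [Pi.mul_apply, norm_mul]
    exact mul_le_mul_of_nonneg_right (hB _) (norm_nonneg _)
  · refine tendsto_const_nhds.congr' ?_
    filter_upwards [eventually_ge_atTop t] with s hs
    simp [h0 (t - s) (by linarith)]

end Potential

/-- Repeated integration by parts in time: `n` vanishing moments of the density turn into `2n` extra
space derivatives on the kernel. -/
lemma exists_heatPotential_eq {T : ℝ} (n : ℕ) : ∀ h : ℝ → ℝ, Continuous h →
    (∀ x ≤ 0, h x = 0) → (∀ x, T ≤ x → h x = 0) →
    (∀ k : ℕ, k < n → ∫ t in (0 : ℝ)..T, t ^ k * h t = 0) →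
    ∃ H : ℝ → ℝ, Continuous H ∧ (∀ x ≤ 0, H x = 0) ∧ (∀ x, T ≤ x → H x = 0) ∧
      ∀ (j : ℕ) (t z : ℝ), 0 < z → heatPotential h j t z = heatPotential H (j + 2 * n) t z := by
  induction n with
  | zero => exact fun h hc h0 hT _ => ⟨h, hc, h0, hT, fun _ _ _ _ => rfl⟩
  | succ n ih =>
    intro h hc h0 hhT hmom
    have hd : ∀ x, HasDerivAt (fun x => ∫ t in (0 : ℝ)..x, h t) (h x) x := fun x =>
      intervalIntegral.integral_hasDerivAt_right (hc.intervalIntegrable _ _)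
        (hc.stronglyMeasurableAtFilter _ _) hc.continuousAt
    have hc1 : Continuous (fun x => ∫ t in (0 : ℝ)..x, h t) :=
      continuous_iff_continuousAt.2 fun x => (hd x).continuousAt
    have h10 : ∀ x ≤ 0, (∫ t in (0 : ℝ)..x, h t) = 0 := fun x hx => by
      refine intervalIntegral.integral_zero_ae (ae_of_all _ fun t ht => h0 t ?_)
      rw [Set.uIoc_of_ge hx] at ht
      exact ht.2
    have h1T : ∀ x, T ≤ x → (∫ t in (0 : ℝ)..x, h t) = 0 := fun x hx => by
      rw [← intervalIntegral.integral_add_adjacent_intervals (hc.intervalIntegrable 0 T)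
        (hc.intervalIntegrable T x)]
      have h2 := hmom 0 (by omega)
      simp only [pow_zero, one_mul] at h2
      rw [h2, zero_add]
      refine intervalIntegral.integral_zero_ae (ae_of_all _ fun t ht => hhT t ?_)
      rw [Set.uIoc_of_le hx] at ht
      exact ht.1.le
    obtain ⟨H, hH, hH0, hHT, hP⟩ := ih _ hc1 h10 h1T fun k hk => by
      have hpow : ∀ x ∈ Set.uIcc 0 T,
          HasDerivAt (fun x : ℝ => x ^ (k + 1) / (k + 1)) (x ^ k) x := fun x _ => by
        have := (hasDerivAt_pow (k + 1) x).div_const ((k : ℝ) + 1)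
        refine this.congr_deriv ?_
        push_cast
        field_simp
      have hibp := intervalIntegral.integral_deriv_mul_eq_sub hpow (fun x _ => hd x)
        ((continuous_pow k).intervalIntegrable _ _) (hc.intervalIntegrable _ _)
      have hi : ∀ g : ℝ → ℝ, Continuous g → IntervalIntegrable g volume 0 T :=
        fun g hg => hg.intervalIntegrable _ _
      rw [intervalIntegral.integral_add (hi _ (by fun_prop)) (hi _ (by fun_prop)),
        h1T T le_rfl, h10 0 le_rfl] at hibp
      have hz : (∫ x in (0 : ℝ)..T, x ^ (k + 1) / (k + 1) * h x) = 0 := by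
        have h3 := hmom (k + 1) (by omega)
        calc _ = ∫ x in (0 : ℝ)..T, (1 / ((k : ℝ) + 1)) * (x ^ (k + 1) * h x) := by
              congr 1; ext x; ring
          _ = 0 := by rw [intervalIntegral.integral_const_mul, h3, mul_zero]
      rw [hz] at hibp
      simpa using hibp
    refine ⟨H, hH, hH0, hHT, fun j t z hz => ?_⟩
    rw [heatPotential_deriv hd hc (hasCompactSupport_of_eq_zero h10 h1T)
      (hasCompactSupport_of_eq_zero h0 hhT) h10 j t hz, hP _ _ _ hz]
    congr 1
    ring

/-- A maximum principle for bounded subsolutions of the heat equation in the quarter plane. -/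
lemma heat_quarterPlane_nonpos {u u₁ u₂ : ℝ → ℝ → ℝ} {M : ℝ}
    (hM : ∀ t ≥ (0 : ℝ), ∀ z ≥ (0 : ℝ), u t z ≤ M)
    (hcont : ContinuousOn (fun p : ℝ × ℝ => u p.1 p.2) (Set.Ici 0 ×ˢ Set.Ici 0))
    (hbc : ∀ t ≥ (0 : ℝ), u t 0 ≤ 0) (hic : ∀ z ≥ (0 : ℝ), u 0 z ≤ 0)
    (h₁ : ∀ t > (0 : ℝ), ∀ z > (0 : ℝ), HasDerivAt (u t) (u₁ t z) z)
    (h₂ : ∀ t > (0 : ℝ), ∀ z > (0 : ℝ), HasDerivAt (u₁ t) (u₂ t z) z)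
    (ht : ∀ t > (0 : ℝ), ∀ z > (0 : ℝ), HasDerivAt (fun τ => u τ z) (u₂ t z) t)
    {t₀ z₀ : ℝ} (ht₀ : 0 ≤ t₀) (hz₀ : 0 ≤ z₀) : u t₀ z₀ ≤ 0 := by
  suffices hε : ∀ ε > (0 : ℝ), u t₀ z₀ ≤ ε * (z₀ ^ 2 + 3 * t₀) by
    refine le_of_forall_pos_le_add fun δ hδ => ?_
    have hA : 0 ≤ z₀ ^ 2 + 3 * t₀ := by positivity
    refine (hε (δ / (z₀ ^ 2 + 3 * t₀ + 1)) (by positivity)).trans ?_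
    rw [zero_add, div_mul_eq_mul_div, div_le_iff₀ (by positivity)]
    nlinarith
  intro ε hε
  obtain ⟨R, hR₀, hR⟩ : ∃ R, z₀ ≤ R ∧ M ≤ ε * R ^ 2 := by
    refine ⟨max z₀ (max 1 (M / ε)), le_max_left _ _, ?_⟩
    have h1 : 1 ≤ max z₀ (max 1 (M / ε)) := (le_max_left _ _).trans (le_max_right _ _)
    have h2 : M / ε ≤ max z₀ (max 1 (M / ε)) := (le_max_right _ _).trans (le_max_right _ _)
    rw [div_le_iff₀ hε] at h2
    nlinarith [mul_le_mul_of_nonneg_left h1 (mul_nonneg hε.le (zero_le_one.trans h1))]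
  set v : ℝ × ℝ → ℝ := fun p => u p.1 p.2 - ε * (p.2 ^ 2 + 3 * p.1) with hv
  suffices hmax : ∀ p ∈ Set.Icc 0 t₀ ×ˢ Set.Icc 0 R, v p ≤ 0 by
    have := hmax (t₀, z₀) ⟨⟨ht₀, le_rfl⟩, ⟨hz₀, hR₀⟩⟩
    simp only [hv] at this
    linarith
  have hvc : ContinuousOn v (Set.Icc 0 t₀ ×ˢ Set.Icc 0 R) :=
    (hcont.mono (Set.prod_mono Set.Icc_subset_Ici_self Set.Icc_subset_Ici_self)).sub
      (by fun_prop)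
  obtain ⟨⟨t, z⟩, ⟨⟨ht0, htt⟩, ⟨hz0, hzR⟩⟩, hmax⟩ :=
    (isCompact_Icc.prod isCompact_Icc).exists_isMaxOn
      ⟨(t₀, z₀), ⟨⟨ht₀, le_rfl⟩, ⟨hz₀, hR₀⟩⟩⟩ hvc
  simp only at ht0 htt hz0 hzR
  suffices hle : v (t, z) ≤ 0 from fun p hp => (hmax hp).trans hle
  have hvtz : v (t, z) = u t z - ε * (z ^ 2 + 3 * t) := rfl
  have hnn : 0 ≤ ε * (z ^ 2 + 3 * t) := by positivity
  rcases ht0.eq_or_lt with rfl | htpos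
  · linarith [hic z hz0]
  rcases hz0.eq_or_lt with rfl | hzpos
  · linarith [hbc t ht0]
  rcases hzR.eq_or_lt with rfl | hzlt
  · have := hM t ht0 z hz0
    nlinarith
  exfalso
  -- the time derivative at the maximum point is nonnegative
  have hdt : HasDerivAt (fun τ => v (τ, z)) (u₂ t z - ε * 3) t := by
    have h3 := (((hasDerivAt_id t).const_mul 3).const_add (z ^ 2)).const_mul ε
    exact ((ht t htpos z hzpos).sub h3).congr_deriv (by simp)
  have htime : 0 ≤ u₂ t z - ε * 3 := by
    have hw := hdt.hasDerivWithinAt (s := Set.Iio t)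
    rw [hasDerivWithinAt_iff_tendsto_slope' (by simp)] at hw
    refine ge_of_tendsto hw ?_
    filter_upwards [Ioo_mem_nhdsLT htpos] with τ hτ
    have hle : v (τ, z) ≤ v (t, z) := hmax ⟨⟨hτ.1.le, hτ.2.le.trans htt⟩, ⟨hz0, hzR⟩⟩
    rw [slope_def_field]
    exact div_nonneg_of_nonpos (by linarith) (by linarith [hτ.2])
  -- so the second space derivative is positive there, contradicting maximality
  have hd₁ : ∀ w > (0 : ℝ), HasDerivAt (fun w => v (t, w)) (u₁ t w - ε * (2 * w)) w := by
    intro w hw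
    have h3 := (((hasDerivAt_pow 2 w)).add_const (3 * t)).const_mul ε
    exact ((h₁ t htpos w hw).sub h3).congr_deriv (by simp)
  have hd₂ : HasDerivAt (fun w => u₁ t w - ε * (2 * w)) (u₂ t z - ε * 2) z := by
    have h3 := ((hasDerivAt_id z).const_mul 2).const_mul ε
    exact ((h₂ t htpos z hzpos).sub h3).congr_deriv (by simp)
  have hder : deriv (fun w => v (t, w)) =ᶠ[𝓝 z] fun w => u₁ t w - ε * (2 * w) := by
    filter_upwards [Ioi_mem_nhds hzpos] with w hw using (hd₁ w hw).deriv
  have hdd : deriv (deriv (fun w => v (t, w))) z = u₂ t z - ε * 2 := by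
    rw [hder.deriv_eq, hd₂.deriv]
  have hlmax : IsLocalMax (fun w => v (t, w)) z := by
    filter_upwards [Ioo_mem_nhds hzpos hzlt] with w hw
    exact hmax ⟨⟨ht0, htt⟩, ⟨hw.1.le, hw.2.le⟩⟩
  have hlmin : IsLocalMin (fun w => v (t, w)) z :=
    isLocalMin_of_deriv_deriv_pos (by rw [hdd]; linarith) hlmax.deriv_eq_zero
      (hd₁ z hzpos).continuousAt
  have hconst : (fun w => v (t, w)) =ᶠ[𝓝 z] fun _ => v (t, z) := by
    filter_upwards [hlmax, hlmin] with w h3 h4 using le_antisymm h3 h4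
  have : deriv (deriv (fun w => v (t, w))) z = 0 := by
    rw [hconst.deriv.deriv_eq]
    simp
  rw [hdd] at this
  linarith

/-- The bounded solution of the heat equation on the half line with Dirichlet data `h`, in
self-similar variables. -/
noncomputable def dirichletSolution (h : ℝ → ℝ) (t z : ℝ) : ℝ :=
  Real.sqrt (2 / Real.pi) *
    ∫ y in Set.Ioi (0 : ℝ), h (t - z ^ 2 / (2 * y ^ 2)) * Real.exp (-(y ^ 2 / 2))

section Dirichlet

variable {h : ℝ → ℝ} {B : ℝ}

lemma integrable_exp_neg_sq_div_two :
    Integrable (fun y : ℝ => Real.exp (-(y ^ 2 / 2))) := by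
  refine (integrable_exp_neg_mul_sq (b := 1 / 2) (by norm_num)).congr (ae_of_all _ fun y => ?_)
  ring_nf

lemma integral_Ioi_exp_neg_sq_div_two :
    Real.sqrt (2 / Real.pi) * ∫ y in Set.Ioi (0 : ℝ), Real.exp (-(y ^ 2 / 2)) = 1 := by
  have h1 := integral_gaussian_Ioi (1 / 2)
  have h2 : ∀ y : ℝ, Real.exp (-(y ^ 2 / 2)) = Real.exp (-(1 / 2) * y ^ 2) := fun y => by ring_nf
  simp_rw [h2, h1]
  rw [mul_div_assoc', ← Real.sqrt_mul (by positivity),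
    show 2 / Real.pi * (Real.pi / (1 / 2)) = 2 ^ 2 by field_simp, Real.sqrt_sq (by norm_num)]
  norm_num

lemma aestronglyMeasurable_dirichletSolution (hc : Continuous h) (t z : ℝ) :
    AEStronglyMeasurable (fun y => h (t - z ^ 2 / (2 * y ^ 2)) * Real.exp (-(y ^ 2 / 2)))
      (volume.restrict (Set.Ioi (0 : ℝ))) := by
  have h1 : Measurable fun y : ℝ => t - z ^ 2 / (2 * y ^ 2) := by fun_prop
  have h2 : Measurable fun y : ℝ => Real.exp (-(y ^ 2 / 2)) := by fun_prop
  exact ((hc.measurable.comp h1).mul h2).aestronglyMeasurable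

lemma norm_dirichletSolution_integrand_le (hB : ∀ x, |h x| ≤ B) (t z y : ℝ) :
    ‖h (t - z ^ 2 / (2 * y ^ 2)) * Real.exp (-(y ^ 2 / 2))‖ ≤ B * Real.exp (-(y ^ 2 / 2)) := by
  rw [norm_mul, Real.norm_eq_abs, Real.norm_eq_abs, Real.abs_exp]
  exact mul_le_mul_of_nonneg_right (hB _) (Real.exp_pos _).le

lemma continuous_dirichletSolution (hc : Continuous h) (hB : ∀ x, |h x| ≤ B) :
    Continuous (fun p : ℝ × ℝ => dirichletSolution h p.1 p.2) := by
  refine continuous_const.mul (continuous_of_dominated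
    (F := fun (p : ℝ × ℝ) y => h (p.1 - p.2 ^ 2 / (2 * y ^ 2)) * Real.exp (-(y ^ 2 / 2)))
    (bound := fun y => B * Real.exp (-(y ^ 2 / 2)))
    (fun p => aestronglyMeasurable_dirichletSolution hc p.1 p.2)
    (fun p => ae_of_all _ fun y => norm_dirichletSolution_integrand_le hB p.1 p.2 y)
    (integrable_exp_neg_sq_div_two.const_mul B).integrableOn (ae_of_all _ fun y => ?_))
  refine (hc.comp ?_).mul continuous_const
  exact continuous_fst.sub ((continuous_snd.pow 2).div_const _)

lemma abs_dirichletSolution_le (hB : ∀ x, |h x| ≤ B) (t z : ℝ) :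
    |dirichletSolution h t z| ≤ B := by
  have h1 := norm_integral_le_of_norm_le (μ := volume.restrict (Set.Ioi (0 : ℝ)))
    (integrable_exp_neg_sq_div_two.const_mul B).integrableOn
    (ae_of_all _ fun y => norm_dirichletSolution_integrand_le hB t z y)
  rw [integral_const_mul] at h1
  rw [dirichletSolution, abs_mul, abs_of_nonneg (Real.sqrt_nonneg _)]
  calc _ ≤ Real.sqrt (2 / Real.pi) *
        (B * ∫ y in Set.Ioi (0 : ℝ), Real.exp (-(y ^ 2 / 2))) :=
        mul_le_mul_of_nonneg_left h1 (Real.sqrt_nonneg _)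
    _ = B * (Real.sqrt (2 / Real.pi) * ∫ y in Set.Ioi (0 : ℝ), Real.exp (-(y ^ 2 / 2))) := by ring
    _ = B := by rw [integral_Ioi_exp_neg_sq_div_two, mul_one]

lemma dirichletSolution_boundary (h : ℝ → ℝ) (t : ℝ) : dirichletSolution h t 0 = h t := by
  have : dirichletSolution h t 0 =
      h t * (Real.sqrt (2 / Real.pi) * ∫ y in Set.Ioi (0 : ℝ), Real.exp (-(y ^ 2 / 2))) := by
    simp only [dirichletSolution, ne_eq, OfNat.ofNat_ne_zero, not_false_eq_true, zero_pow, zero_div,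
      sub_zero, integral_const_mul]
    ring
  rw [this, integral_Ioi_exp_neg_sq_div_two, mul_one]

lemma dirichletSolution_initial (h0 : ∀ x ≤ 0, h x = 0) (z : ℝ) : dirichletSolution h 0 z = 0 := by
  have h1 : ∀ y : ℝ, h (0 - z ^ 2 / (2 * y ^ 2)) = 0 := fun y => h0 _ (by
    have : 0 ≤ z ^ 2 / (2 * y ^ 2) := by positivity
    linarith)
  simp only [dirichletSolution, h1, zero_mul, integral_zero, mul_zero]

lemma dirichletSolution_eq_heatPotential (h : ℝ → ℝ) (t : ℝ) {z : ℝ} (hz : 0 < z) :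
    dirichletSolution h t z = -Real.sqrt (2 / Real.pi) * heatPotential h 1 t z := by
  have himg : (fun s => z * heatScale s) '' Set.Ioi 0 = Set.Ioi 0 := by
    ext y
    constructor
    · rintro ⟨s, hs, rfl⟩
      exact mul_pos hz (heatScale_pos hs)
    · intro hy
      have hy : 0 < y := hy
      refine ⟨z ^ 2 / (2 * y ^ 2), by simp only [Set.mem_Ioi]; positivity, ?_⟩
      simp only [heatScale]
      rw [show 2 * (z ^ 2 / (2 * y ^ 2)) = (z / y) ^ 2 by field_simp, Real.sqrt_sq (by positivity)]
      field_simp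
  have hinj : Set.InjOn (fun s => z * heatScale s) (Set.Ioi 0) := by
    intro a ha b hb hab
    have h1 : heatScale a ^ 2 = heatScale b ^ 2 := by rw [mul_left_cancel₀ hz.ne' hab]
    rw [heatScale_sq ha, heatScale_sq hb] at h1
    have ha : 0 < a := ha
    have hb : 0 < b := hb
    field_simp at h1
    exact h1.symm
  have hcv := integral_image_eq_integral_abs_deriv_smul measurableSet_Ioi
    (fun s hs => ((hasDerivAt_heatScale hs).const_mul z).hasDerivWithinAt) hinj
    (fun y => h (t - z ^ 2 / (2 * y ^ 2)) * Real.exp (-(y ^ 2 / 2)))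
  rw [himg] at hcv
  rw [dirichletSolution, heatPotential, hcv, neg_mul, ← mul_neg, ← integral_neg]
  congr 1
  refine setIntegral_congr_fun measurableSet_Ioi fun s hs => ?_
  have hs : 0 < s := hs
  have hσ := heatScale_pos hs
  have h1 : z ^ 2 / (2 * (z * heatScale s) ^ 2) = s := by
    rw [mul_pow, heatScale_sq hs]
    field_simp
  have h2 : |z * -heatScale s ^ 3| = z * heatScale s ^ 3 := by
    rw [mul_neg, abs_neg, abs_of_pos (by positivity)]
  simp only [h1, h2, smul_eq_mul, heatKer, gaussDeriv_one, gaussDeriv_zero]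
  ring

end Dirichlet

lemma hasDerivAt_dirichletSolution_space {h : ℝ → ℝ} (hc : Continuous h) (hs : HasCompactSupport h)
    (t : ℝ) {z : ℝ} (hz : 0 < z) :
    HasDerivAt (dirichletSolution h t) (-Real.sqrt (2 / Real.pi) * heatPotential h 2 t z) z := by
  refine ((hasDerivAt_heatPotential_space hc hs 1 t hz).const_mul _).congr_of_eventuallyEq ?_
  filter_upwards [Ioi_mem_nhds hz] with w hw using dirichletSolution_eq_heatPotential h t hw

lemma hasDerivAt_dirichletSolution_time {h : ℝ → ℝ} (hsmooth : ContDiff ℝ (⊤ : ℕ∞) h)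
    (hs : HasCompactSupport h) (h0 : ∀ x ≤ 0, h x = 0) (t : ℝ) {z : ℝ} (hz : 0 < z) :
    HasDerivAt (fun t => dirichletSolution h t z)
      (-Real.sqrt (2 / Real.pi) * heatPotential h 3 t z) t := by
  have hd : ∀ x, HasDerivAt h (deriv h x) x := fun x =>
    ((hsmooth.differentiable (by simp)) x).hasDerivAt
  have hc' : Continuous (deriv h) := hsmooth.continuous_deriv (by simp)
  have h0' : ∀ x ≤ 0, deriv h x = 0 := fun x hx => by
    have h1 : HasDerivWithinAt h 0 (Set.Iic x) x :=
      (hasDerivWithinAt_const x _ 0).congr (fun y hy => h0 y (le_trans hy hx)) (h0 x hx)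
    exact (uniqueDiffWithinAt_Iic x).eq_deriv _ (hd x).hasDerivWithinAt h1
  have h1 := (hasDerivAt_heatPotential_time hd hc' hs hs.deriv h0' 1 t hz).const_mul
    (-Real.sqrt (2 / Real.pi))
  rw [heatPotential_deriv hd hc' hs hs.deriv h0 1 t hz] at h1
  simpa only [← dirichletSolution_eq_heatPotential h _ hz] using h1

/-- Uniqueness of bounded solutions of the Dirichlet problem on the half line. -/
lemma eq_dirichletSolution {h : ℝ → ℝ} (hsmooth : ContDiff ℝ (⊤ : ℕ∞) h)
    (hs : HasCompactSupport h) (h0 : ∀ x ≤ 0, h x = 0) {V : ℝ → ℝ → ℝ}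
    (hVbdd : ∃ M : ℝ, ∀ t ≥ (0:ℝ), ∀ z ≥ (0:ℝ), |V t z| ≤ M)
    (hVcont : ContinuousOn (fun p : ℝ × ℝ => V p.1 p.2) (Set.Ici (0:ℝ) ×ˢ Set.Ici (0:ℝ)))
    (hVsmooth : ContDiffOn ℝ (⊤ : ℕ∞) (fun p : ℝ × ℝ => V p.1 p.2)
      (Set.Ioi (0:ℝ) ×ˢ Set.Ici (0:ℝ)))
    (hheat : ∀ t > (0:ℝ), ∀ z > (0:ℝ), deriv (fun τ => V τ z) t = iteratedDeriv 2 (V t) z)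
    (hbc : ∀ t ≥ (0:ℝ), V t 0 = h t) (hic : ∀ z ≥ (0:ℝ), V 0 z = 0)
    {t z : ℝ} (ht : 0 ≤ t) (hz : 0 ≤ z) : V t z = dirichletSolution h t z := by
  have hc := hsmooth.continuous
  obtain ⟨B, hB⟩ := hc.bounded_above_of_compact_support hs
  obtain ⟨M, hM⟩ := hVbdd
  have hWb := abs_dirichletSolution_le hB
  have hWc := (continuous_dirichletSolution hc hB).continuousOn
    (s := Set.Ici (0:ℝ) ×ˢ Set.Ici (0:ℝ))
  have hsm : ∀ t > (0 : ℝ), ContDiffOn ℝ (⊤ : ℕ∞) (V t) (Set.Ioi 0) := fun t ht =>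
    hVsmooth.comp (f := fun z => (t, z)) (by fun_prop) fun z hz => ⟨ht, Set.Ioi_subset_Ici_self hz⟩
  have hV₁ : ∀ t > (0 : ℝ), ∀ z > (0 : ℝ), HasDerivAt (V t) (deriv (V t) z) z := fun t ht z hz =>
    (((hsm t ht).differentiableOn (by simp)).differentiableAt (Ioi_mem_nhds hz)).hasDerivAt
  have hV₂ : ∀ t > (0 : ℝ), ∀ z > (0 : ℝ),
      HasDerivAt (deriv (V t)) (iteratedDeriv 2 (V t) z) z := fun t ht z hz => by
    have h1 : ContDiffOn ℝ (⊤ : ℕ∞) (deriv (V t)) (Set.Ioi 0) :=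
      (hsm t ht).deriv_of_isOpen isOpen_Ioi le_rfl
    rw [iteratedDeriv_succ, iteratedDeriv_one]
    exact ((h1.differentiableOn (by simp)).differentiableAt (Ioi_mem_nhds hz)).hasDerivAt
  have hVt : ∀ t > (0 : ℝ), ∀ z > (0 : ℝ),
      HasDerivAt (fun τ => V τ z) (iteratedDeriv 2 (V t) z) t := fun t ht z hz => by
    have h1 : ContDiffOn ℝ (⊤ : ℕ∞) (fun τ => V τ z) (Set.Ioi 0) :=
      hVsmooth.comp (f := fun τ => (τ, z)) (by fun_prop) fun τ hτ => ⟨hτ, le_of_lt hz⟩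
    rw [← hheat t ht z hz]
    exact ((h1.differentiableOn (by simp)).differentiableAt (Ioi_mem_nhds ht)).hasDerivAt
  have hW₁ := fun (t : ℝ) (_ : t > 0) (z : ℝ) (hz : z > 0) =>
    hasDerivAt_dirichletSolution_space hc hs t hz
  have hW₂ := fun (t : ℝ) (_ : t > 0) (z : ℝ) (hz : z > 0) =>
    (hasDerivAt_heatPotential_space hc hs 2 t hz).const_mul (-Real.sqrt (2 / Real.pi))
  have hWt := fun (t : ℝ) (_ : t > 0) (z : ℝ) (hz : z > 0) =>
    hasDerivAt_dirichletSolution_time hsmooth hs h0 t hz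
  have hle := heat_quarterPlane_nonpos (u := fun t z => V t z - dirichletSolution h t z)
    (M := M + B)
    (fun t ht z hz => by
      linarith [(abs_le.1 (hM t ht z hz)).2, (abs_le.1 (hWb t z)).1])
    (hVcont.sub hWc)
    (fun t ht => by rw [hbc t ht, dirichletSolution_boundary, sub_self])
    (fun z hz => by rw [hic z hz, dirichletSolution_initial h0, sub_self])
    (fun t ht z hz => (hV₁ t ht z hz).sub (hW₁ t ht z hz))
    (fun t ht z hz => (hV₂ t ht z hz).sub (hW₂ t ht z hz))
    (fun t ht z hz => (hVt t ht z hz).sub (hWt t ht z hz)) ht hz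
  have hge := heat_quarterPlane_nonpos (u := fun t z => dirichletSolution h t z - V t z)
    (M := M + B)
    (fun t ht z hz => by
      linarith [(abs_le.1 (hM t ht z hz)).1, (abs_le.1 (hWb t z)).2])
    (hWc.sub hVcont)
    (fun t ht => by rw [hbc t ht, dirichletSolution_boundary, sub_self])
    (fun z hz => by rw [hic z hz, dirichletSolution_initial h0, sub_self])
    (fun t ht z hz => (hW₁ t ht z hz).sub (hV₁ t ht z hz))
    (fun t ht z hz => (hW₂ t ht z hz).sub (hV₂ t ht z hz))
    (fun t ht z hz => (hWt t ht z hz).sub (hVt t ht z hz)) ht hz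
  linarith

lemma iteratedDeriv_eq_heatPotential {H v : ℝ → ℝ} (hc : Continuous H) (hs : HasCompactSupport H)
    {c t : ℝ} {j : ℕ} (hv : ∀ z > (0 : ℝ), v z = c * heatPotential H j t z) (α : ℕ) :
    ∀ z > (0 : ℝ), iteratedDeriv α v z = c * heatPotential H (j + α) t z := by
  induction α with
  | zero => simpa using hv
  | succ α ih =>
    intro z hz
    have h1 : iteratedDeriv α v =ᶠ[𝓝 z] fun z => c * heatPotential H (j + α) t z := by
      filter_upwards [Ioi_mem_nhds hz] with w hw using ih w hw
    rw [iteratedDeriv_succ, h1.deriv_eq]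
    exact ((hasDerivAt_heatPotential_space hc hs (j + α) t hz).const_mul c).deriv

lemma exists_abs_heatPotential_le {T : ℝ} (hT : 0 < T) {H : ℝ → ℝ} (hc : Continuous H)
    (h0 : ∀ x ≤ 0, H x = 0) (hHT : ∀ x, T ≤ x → H x = 0) (j : ℕ) :
    ∃ C, 0 ≤ C ∧ ∀ t ≥ 2 * T, ∀ z > (0 : ℝ),
      |heatPotential H j t z| ≤ C * (Real.sqrt t)⁻¹ ^ (j + 1) * Real.exp (-(z ^ 2 / (8 * t))) := by
  obtain ⟨B, hB⟩ := hc.bounded_above_of_compact_support (hasCompactSupport_of_eq_zero h0 hHT)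
  have hB0 : 0 ≤ B := (norm_nonneg _).trans (hB 0)
  obtain ⟨C, hC, h⟩ := exists_abs_heatKer_le j 0
  refine ⟨B * C * T, by positivity, fun t ht z hz => ?_⟩
  have ht0 : 0 < t := by linarith
  have hpos : ∀ s ∈ Set.Icc (t - T) t, 0 < s := fun s hs => by linarith [hs.1]
  have hset : heatPotential H j t z = ∫ s in Set.Icc (t - T) t, H (t - s) * heatKer j s z := by
    refine setIntegral_eq_of_subset_of_forall_sdiff_eq_zero measurableSet_Ioi hpos
      fun s hs => ?_
    by_cases hst : t ≤ s
    · rw [h0 _ (by linarith), zero_mul]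
    · rw [hHT _ (le_of_not_gt fun hlt => hs.2 ⟨by linarith, by linarith⟩), zero_mul]
  rw [hset, ← Real.norm_eq_abs]
  refine (norm_setIntegral_le_of_norm_le_const
    (C := B * (C * (Real.sqrt t)⁻¹ ^ (j + 1) * Real.exp (-(z ^ 2 / (8 * t)))))
    (by simp) fun s hs => ?_).trans_eq ?_
  · have hs0 := hpos s hs
    have h1 := h s hs0 z hz
    simp only [pow_zero, one_mul] at h1
    have hσ : heatScale s ≤ (Real.sqrt t)⁻¹ := by
      rw [heatScale]
      gcongr
      linarith [hs.1]
    have hσ0 := heatScale_pos hs0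
    have hst := hs.2
    rw [norm_mul]
    refine mul_le_mul (hB _) (h1.trans ?_) (norm_nonneg _) hB0
    gcongr
  · rw [Real.volume_real_Icc_of_le (by linarith)]
    ring

lemma exists_weightedIntegral_le {T : ℝ} (hT : 0 < T) (m : ℕ) :
    ∃ D, 0 ≤ D ∧ ∀ t ≥ 2 * T, ∀ (A : ℝ) (g : ℝ → ℝ),
      (∀ z > (0 : ℝ), |g z| ≤ A * Real.exp (-(z ^ 2 / (8 * t)))) →
      ∫ z in Set.Ioi (0 : ℝ), (1 + z ^ 2) ^ m * g z ^ 2 ≤ D * A ^ 2 * (t ^ m * Real.sqrt t) := by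
  set a : ℝ := 1 + 1 / (2 * T) with ha
  set b : ℝ := 8 ^ m * m.factorial * Real.exp (1 / 8) with hb
  refine ⟨a ^ m * b * (Real.sqrt (8 * Real.pi) / 2), by positivity, fun t ht A g hg => ?_⟩
  have ht0 : 0 < t := by linarith
  have hweight : ∀ z : ℝ, (1 + z ^ 2) ^ m ≤ a ^ m * t ^ m * (b * Real.exp (z ^ 2 / (8 * t))) := by
    intro z
    have h1 : 1 + z ^ 2 ≤ a * t * (1 + z ^ 2 / t) := by
      have h2 : a * t * (1 + z ^ 2 / t) = a * (t + z ^ 2) := by field_simp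
      have h3 : 1 ≤ 1 / (2 * T) * t := by
        rw [div_mul_eq_mul_div, le_div_iff₀ (by positivity)]
        linarith
      have h4 : (0 : ℝ) ≤ 1 / (2 * T) * z ^ 2 := by positivity
      rw [h2, ha]
      nlinarith
    have h5 := Real.pow_div_factorial_le_exp ((1 + z ^ 2 / t) / 8) (by positivity) m
    have h6 : Real.exp ((1 + z ^ 2 / t) / 8) = Real.exp (1 / 8) * Real.exp (z ^ 2 / (8 * t)) := by
      rw [← Real.exp_add]
      congr 1
      field_simp
    rw [h6, div_pow, div_div, div_le_iff₀ (by positivity)] at h5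
    calc (1 + z ^ 2) ^ m ≤ (a * t * (1 + z ^ 2 / t)) ^ m := by gcongr
      _ = a ^ m * t ^ m * (1 + z ^ 2 / t) ^ m := by rw [mul_pow, mul_pow]
      _ ≤ a ^ m * t ^ m * (b * Real.exp (z ^ 2 / (8 * t))) := by
        refine mul_le_mul_of_nonneg_left (h5.trans_eq ?_) (by positivity)
        rw [hb]
        ring
  have hexp : ∀ z : ℝ, Real.exp (-(1 / (8 * t)) * z ^ 2) = Real.exp (-(z ^ 2 / (8 * t))) :=
    fun z => by ring_nf
  have hgauss := integral_gaussian_Ioi (1 / (8 * t))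
  have hint : Integrable (fun z : ℝ => Real.exp (-(1 / (8 * t)) * z ^ 2)) :=
    integrable_exp_neg_mul_sq (by positivity)
  calc ∫ z in Set.Ioi (0 : ℝ), (1 + z ^ 2) ^ m * g z ^ 2
      ≤ ∫ z in Set.Ioi (0 : ℝ), a ^ m * t ^ m * b * A ^ 2 * Real.exp (-(1 / (8 * t)) * z ^ 2) := by
        refine integral_mono_of_nonneg (ae_of_all _ fun z => by positivity)
          (hint.const_mul _).integrableOn ?_
        filter_upwards [ae_restrict_mem measurableSet_Ioi] with z hz
        have h1 : g z ^ 2 ≤ (A * Real.exp (-(z ^ 2 / (8 * t)))) ^ 2 := by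
          rw [← sq_abs]
          exact pow_le_pow_left₀ (abs_nonneg _) (hg z hz) 2
        calc (1 + z ^ 2) ^ m * g z ^ 2
            ≤ a ^ m * t ^ m * (b * Real.exp (z ^ 2 / (8 * t))) *
              (A * Real.exp (-(z ^ 2 / (8 * t)))) ^ 2 :=
              mul_le_mul (hweight z) h1 (sq_nonneg _) (by positivity)
          _ = a ^ m * t ^ m * b * A ^ 2 * Real.exp (-(z ^ 2 / (8 * t))) *
              (Real.exp (z ^ 2 / (8 * t)) * Real.exp (-(z ^ 2 / (8 * t)))) := by ring
          _ = _ := by rw [← Real.exp_add, add_neg_cancel, Real.exp_zero, mul_one, hexp]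
    _ = _ := by
        rw [integral_const_mul, hgauss,
          show Real.pi / (1 / (8 * t)) = 8 * Real.pi * t by field_simp,
          Real.sqrt_mul (by positivity)]
        ring

lemma pow_inv_mul_pow_mul_sqrt {t : ℝ} (ht : 0 < t) (n m : ℕ) :
    t⁻¹ ^ (2 * n + 2) * (t ^ m * Real.sqrt t) =
      (t⁻¹ ^ ((1:ℝ)/4 + (2 * (n:ℝ) + 1)/2 - (m:ℝ)/2)) ^ 2 := by
  rw [← Real.rpow_natCast, ← Real.rpow_natCast, ← Real.rpow_natCast, Real.sqrt_eq_rpow,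
    Real.inv_rpow ht.le, Real.inv_rpow ht.le, ← Real.rpow_neg ht.le, ← Real.rpow_neg ht.le,
    ← Real.rpow_mul ht.le, ← Real.rpow_add ht, ← Real.rpow_add ht]
  congr 1
  push_cast
  ring

/-- Lemma 4.1 of the paper, well-prepared dissipation:
large-time decay of the boundary layer profile `V` solving the heat equation on
the half line with Dirichlet data `h`, provided `h` is supported in
`(0,T/3] ∪ [2T/3,T)` and has `n` vanishing moments: for each `0 ≤ m ≤ 2n+1`
there is `C > 0` with
`|V(t,·)|_{H^{s,m}(ℝ₊)} ≤ C (ln(2+t)/(2+t))^{1/4 + (2n+1)/2 - m/2}` for `t ≥ 0`. -/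
theorem boundary_layer_decay
    (T : ℝ) (hT : 0 < T) (s n : ℕ)
    (h : ℝ → ℝ) (hsmooth : ContDiff ℝ (⊤ : ℕ∞) h)
    (hsupp : Function.support h ⊆ Set.Ioc 0 (T/3) ∪ Set.Ico (2*T/3) T)
    (hmom : ∀ k : ℕ, k < n → ∫ t in (0:ℝ)..T, t ^ k * h t = 0)
    (V : ℝ → ℝ → ℝ)
    (hVbdd : ∃ M : ℝ, ∀ t ≥ (0:ℝ), ∀ z ≥ (0:ℝ), |V t z| ≤ M)
    (hVcont : ContinuousOn (fun p : ℝ × ℝ => V p.1 p.2)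
      (Set.Ici (0:ℝ) ×ˢ Set.Ici (0:ℝ)))
    (hVsmooth : ContDiffOn ℝ (⊤ : ℕ∞) (fun p : ℝ × ℝ => V p.1 p.2)
      (Set.Ioi (0:ℝ) ×ˢ Set.Ici (0:ℝ)))
    (hheat : ∀ t > (0:ℝ), ∀ z > (0:ℝ),
      deriv (fun τ => V τ z) t = iteratedDeriv 2 (V t) z)
    (hbc : ∀ t ≥ (0:ℝ), V t 0 = h t)
    (hic : ∀ z ≥ (0:ℝ), V 0 z = 0)
    (hfin : ∀ m ≤ 2 * n + 1, ∀ α ≤ s, ∀ t ≥ (0:ℝ),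
      IntegrableOn (fun z => (1 + z ^ 2) ^ m * (iteratedDeriv α (V t) z) ^ 2)
        (Set.Ioi (0:ℝ)))
    (hlocbdd : ∀ m ≤ 2 * n + 1, ∀ K > (0:ℝ), ∃ M : ℝ,
      ∀ t ∈ Set.Icc (0:ℝ) K, weightedSobolevNorm s m (V t) ≤ M) :
    ∀ m ≤ 2 * n + 1, ∃ C > (0:ℝ), ∀ t ≥ (0:ℝ),
      weightedSobolevNorm s m (V t) ≤
        C * (Real.log (2 + t) / (2 + t)) ^
          ((1:ℝ)/4 + (2 * (n:ℝ) + 1)/2 - (m:ℝ)/2) := by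
  have h0 : ∀ x ≤ 0, h x = 0 := fun x hx => by
    by_contra hne
    rcases hsupp hne with hm | hm
    · exact absurd hm.1 (not_lt.2 hx)
    · linarith [hm.1]
  have hhT : ∀ x, T ≤ x → h x = 0 := fun x hx => by
    by_contra hne
    rcases hsupp hne with hm | hm
    · linarith [hm.2]
    · exact absurd hm.2 (not_lt.2 hx)
  have hcs := hasCompactSupport_of_eq_zero h0 hhT
  obtain ⟨H, hHc, hH0, hHT, hH⟩ := exists_heatPotential_eq n h hsmooth.continuous h0 hhT hmom
  have hHcs := hasCompactSupport_of_eq_zero hH0 hHT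
  have hV : ∀ t ≥ 0, ∀ z > 0,
      V t z = -Real.sqrt (2 / Real.pi) * heatPotential H (1 + 2 * n) t z := fun t ht z hz => by
    rw [eq_dirichletSolution hsmooth hcs h0 hVbdd hVcont hVsmooth hheat hbc hic ht hz.le,
      dirichletSolution_eq_heatPotential h t hz, hH 1 t z hz]
  intro m hm
  set p : ℝ := (1:ℝ)/4 + (2 * (n:ℝ) + 1)/2 - (m:ℝ)/2 with hp
  have hp0 : 0 ≤ p := by
    have : (m : ℝ) ≤ 2 * n + 1 := by exact_mod_cast hm
    rw [hp]
    linarith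
  have hlog2 : 0 < Real.log 2 := Real.log_pos (by norm_num)
  have hlog : ∀ t ≥ (0 : ℝ), Real.log 2 ≤ Real.log (2 + t) := fun t ht =>
    Real.log_le_log (by norm_num) (by linarith)
  -- bounded times
  obtain ⟨M, hM⟩ := hlocbdd m hm (2 * T) (by positivity)
  set r : ℝ := (Real.log 2 / (2 + 2 * T)) ^ p with hr
  have hr0 : 0 < r := by positivity
  have hsmall : ∀ t ∈ Set.Icc (0 : ℝ) (2 * T), weightedSobolevNorm s m (V t) ≤
      |M| / r * (Real.log (2 + t) / (2 + t)) ^ p := fun t ht => by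
    have hrt : r ≤ (Real.log (2 + t) / (2 + t)) ^ p := by
      have := hlog t ht.1
      have h1 := ht.1
      have h2 := ht.2
      have h3 : 0 ≤ Real.log (2 + t) := hlog2.le.trans this
      rw [hr]
      gcongr
    calc _ ≤ |M| := (hM t ht).trans (le_abs_self M)
      _ = |M| / r * r := by field_simp
      _ ≤ _ := by gcongr
  -- large times
  choose C hC0 hC using fun α : ℕ => exists_abs_heatPotential_le hT hHc hH0 hHT (1 + 2 * n + α)
  obtain ⟨D, hD0, hD⟩ := exists_weightedIntegral_le hT m
  set E : ℝ := ∑ α ∈ Finset.range (s + 1),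
    D * (Real.sqrt (2 / Real.pi) * C α) ^ 2 * (2 * T)⁻¹ ^ α with hE
  have hE0 : 0 ≤ E := Finset.sum_nonneg fun α _ => by positivity
  have hlarge : ∀ t ≥ 2 * T, weightedSobolevNorm s m (V t) ≤ Real.sqrt E * t⁻¹ ^ p := fun t ht => by
    have ht0 : 0 < t := by linarith
    have hsum : ∑ α ∈ Finset.range (s + 1),
        ∫ z in Set.Ioi (0:ℝ), (1 + z ^ 2) ^ m * (iteratedDeriv α (V t) z) ^ 2 ≤
        E * (t⁻¹ ^ p) ^ 2 := by
      rw [hE, Finset.sum_mul, ← pow_inv_mul_pow_mul_sqrt ht0]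
      refine Finset.sum_le_sum fun α _ => ?_
      refine (hD t ht (Real.sqrt (2 / Real.pi) * C α * (Real.sqrt t)⁻¹ ^ (1 + 2 * n + α + 1))
        (iteratedDeriv α (V t)) fun z hz => ?_).trans ?_
      · rw [iteratedDeriv_eq_heatPotential hHc hHcs (hV t ht0.le) α z hz, abs_mul, abs_neg,
          abs_of_nonneg (Real.sqrt_nonneg _), mul_assoc, mul_assoc, ← mul_assoc (C α)]
        exact mul_le_mul_of_nonneg_left (hC α t ht z hz) (Real.sqrt_nonneg _)
      · have hq : ((Real.sqrt t)⁻¹ ^ (1 + 2 * n + α + 1)) ^ 2 = t⁻¹ ^ (2 * n + 2) * t⁻¹ ^ α := by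
          rw [← pow_mul, mul_comm, pow_mul, inv_pow (Real.sqrt t), Real.sq_sqrt ht0.le, ← pow_add]
          congr 1
          ring
        have hinv : t⁻¹ ^ α ≤ (2 * T)⁻¹ ^ α := by gcongr
        rw [mul_pow, hq]
        calc _ = D * (Real.sqrt (2 / Real.pi) * C α) ^ 2 *
              (t⁻¹ ^ (2 * n + 2) * (t ^ m * Real.sqrt t)) * t⁻¹ ^ α := by ring
          _ ≤ D * (Real.sqrt (2 / Real.pi) * C α) ^ 2 *
              (t⁻¹ ^ (2 * n + 2) * (t ^ m * Real.sqrt t)) * (2 * T)⁻¹ ^ α := by gcongr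
          _ = _ := by ring
    rw [weightedSobolevNorm]
    refine (Real.sqrt_le_sqrt hsum).trans_eq ?_
    rw [Real.sqrt_mul hE0, Real.sqrt_sq (by positivity)]
  set κ : ℝ := (1 + 1 / T) / Real.log 2 with hκ
  have hκ0 : 0 < κ := by positivity
  have hcomp : ∀ t ≥ 2 * T, t⁻¹ ^ p ≤ κ ^ p * (Real.log (2 + t) / (2 + t)) ^ p := fun t ht => by
    have ht0 : 0 < t := by linarith
    have hl := hlog t ht0.le
    rw [← Real.mul_rpow hκ0.le (div_nonneg (hlog2.le.trans hl) (by linarith))]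
    refine Real.rpow_le_rpow (by positivity) ?_ hp0
    have h1 : 2 + t ≤ (1 + 1 / T) * t := by
      have : 2 ≤ 1 / T * t := by
        rw [div_mul_eq_mul_div, le_div_iff₀ hT]
        linarith
      linarith
    have h2 : 1 ≤ Real.log (2 + t) / Real.log 2 := (one_le_div hlog2).2 hl
    calc t⁻¹ ≤ (1 + 1 / T) / (2 + t) := by
          rw [inv_eq_one_div, div_le_div_iff₀ ht0 (by linarith)]
          linarith
      _ ≤ (1 + 1 / T) / (2 + t) * (Real.log (2 + t) / Real.log 2) :=
          le_mul_of_one_le_right (by positivity) h2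
      _ = κ * (Real.log (2 + t) / (2 + t)) := by
          rw [hκ]
          ring
  refine ⟨|M| / r + Real.sqrt E * κ ^ p + 1, by positivity, fun t ht => ?_⟩
  have hw : 0 ≤ (Real.log (2 + t) / (2 + t)) ^ p :=
    Real.rpow_nonneg (div_nonneg (hlog2.le.trans (hlog t ht)) (by linarith)) _
  have hMr : 0 ≤ |M| / r * (Real.log (2 + t) / (2 + t)) ^ p := by positivity
  have hEr : 0 ≤ Real.sqrt E * κ ^ p * (Real.log (2 + t) / (2 + t)) ^ p := by positivity
  rw [add_mul, add_mul, one_mul]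
  rcases le_total t (2 * T) with h1 | h1
  · linarith [hsmall t ⟨ht, h1⟩]
  · have h2 := mul_le_mul_of_nonneg_left (hcomp t h1) (Real.sqrt_nonneg E)
    linarith [hlarge t h1]
end

section
/- There exists a constant C > 0 with the following property. Let k ∈ ℤ and let a = (a₁, a₂) : ℝ × [-1,1] → ℝ² be continuously differentiable with a and its first partial derivatives square-integrable on ℝ × (-1,1), with a(x,-1) = a(x,1) = 0 for all x, with ∂_x a₁ + ∂_y a₂ = 0, and such that for every y ∈ [-1,1] the function x ↦ a(x,y) is integrable and its Fourier transform ξ ↦ ∫_ℝ a(x,y) e^{-i x ξ} dx vanishes for every ξ with 2^{-k}|ξ| ∉ [1/100, 100]. Then (∫_ℝ (sup_{y∈[-1,1]} |a₂(x,y)|)² dx)^{1/2} ≤ C · 2^{k/2} · (∫_ℝ ∫_{-1}^{1} |a(x,y)|² dy dx)^{1/2}. -/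
open MeasureTheory Set Complex

open FourierTransform SchwartzMap in
open scoped ContDiff in
/-- For a function in `L¹ ∩ L²`, the Fourier integral represents the `L²` Fourier transform. -/
theorem fourier_toLp_ae_eq {h : ℝ → ℂ} (h1 : Integrable h) (h2 : MemLp h 2) :
    ((𝓕 (h2.toLp h) : Lp ℂ 2 (volume : Measure ℝ)) : ℝ → ℂ) =ᵐ[volume] 𝓕 h := by
  have hcont : Continuous (𝓕 h) :=
    VectorFourier.fourierIntegral_continuous Real.continuous_fourierChar continuous_inner h1
  refine ae_eq_of_integral_contDiff_smul_eq ((Lp.memLp _).locallyIntegrable (by norm_num))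
    hcont.locallyIntegrable fun g hg hgc ↦ ?_
  have hg₁ : HasCompactSupport (Complex.ofRealCLM ∘ g) := hgc.comp_left rfl
  have hg₂ : ContDiff ℝ ∞ (Complex.ofRealCLM ∘ g) := by fun_prop
  set G : 𝓢(ℝ, ℂ) := hg₁.toSchwartzMap hg₂
  have key := congrArg (fun T ↦ T G) (Lp.fourier_toTemperedDistribution_eq (h2.toLp h))
  simp only [TemperedDistribution.fourier_apply, Lp.toTemperedDistribution_apply] at key
  have e1 : ∫ x, (𝓕 G) x • (h2.toLp h : ℝ → ℂ) x = ∫ x, (𝓕 G) x • h x :=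
    integral_congr_ae (h2.coeFn_toLp.mono fun x hx ↦ by simp only [hx])
  have e2 : ∫ x, (𝓕 (G : ℝ → ℂ)) x • h x = ∫ x, G x • 𝓕 h x := by
    simpa using! VectorFourier.integral_fourierIntegral_smul_eq_flip (L := innerₗ ℝ)
      Real.continuous_fourierChar continuous_inner G.integrable h1
  calc _ = ∫ x, G x • (𝓕 (h2.toLp h) : Lp ℂ 2 (volume : Measure ℝ)) x := rfl
    _ = ∫ x, G x • 𝓕 h x := by rw [← key, e1, SchwartzMap.fourier_coe, e2]
    _ = _ := rfl

open FourierTransform in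
theorem integral_norm_sq_fourier_eq {h : ℝ → ℂ} (h1 : Integrable h) (h2 : MemLp h 2) :
    MemLp (𝓕 h) 2 ∧ ∫ x, ‖𝓕 h x‖ ^ 2 = ∫ x, ‖h x‖ ^ 2 := by
  have hae := fourier_toLp_ae_eq h1 h2
  refine ⟨(memLp_congr_ae hae).1 (Lp.memLp _), ?_⟩
  have h3 : (‖𝓕 (h2.toLp h)‖ : ℝ) ^ 2 = ‖h2.toLp h‖ ^ 2 := by rw [Lp.norm_fourier_eq]
  have sq (u : Lp ℂ 2 (volume : Measure ℝ)) : ‖u‖ ^ 2 = ∫ x, ‖u x‖ ^ 2 := by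
    rw [← inner_self_eq_norm_sq (𝕜 := ℂ), L2.inner_def, ← integral_re (L2.integrable_inner u u)]
    exact integral_congr_ae (.of_forall fun x ↦ inner_self_eq_norm_sq (𝕜 := ℂ) (u x))
  rw [sq, sq] at h3
  rw [integral_congr_ae (g := fun x ↦ ‖(𝓕 (h2.toLp h) : Lp ℂ 2 (volume : Measure ℝ)) x‖ ^ 2)
    (hae.mono fun x hx ↦ by simp only [hx]), h3]
  exact integral_congr_ae (h2.coeFn_toLp.mono fun x hx ↦ by simp only [hx])

open FourierTransform in
/-- **Bernstein's inequality** in `L²`, on the Fourier side: if `g` is continuous and supported in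
`{2π|w| ≤ R}` then the derivative of `𝓕 g` is controlled by `R`. -/
theorem integral_norm_deriv_fourier_sq_le {g : ℝ → ℂ} {R : ℝ} (hgc : Continuous g)
    (hg0 : ∀ w : ℝ, R < 2 * Real.pi * |w| → g w = 0) :
    ∃ D : ℝ → ℂ, (∀ w, HasDerivAt (𝓕 g) (D w) w) ∧ MemLp (𝓕 g) 2 ∧ MemLp D 2 ∧
      ∫ w, ‖D w‖ ^ 2 ≤ R ^ 2 * ∫ w, ‖𝓕 g w‖ ^ 2 := by
  have hgs : HasCompactSupport g := by
    refine HasCompactSupport.intro (isCompact_closedBall (0 : ℝ) (R / (2 * Real.pi))) fun w hw ↦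
      hg0 w ?_
    rw [Metric.mem_closedBall, dist_zero_right, Real.norm_eq_abs, not_le,
      div_lt_iff₀ Real.two_pi_pos] at hw
    linarith
  have hgi : Integrable g := hgc.integrable_of_hasCompactSupport hgs
  have hg2 : MemLp g 2 := hgc.memLp_of_hasCompactSupport hgs
  obtain ⟨d, hd⟩ : ∃ d : ℝ → ℂ, d = fun x : ℝ ↦ (-2 * Real.pi * I * x : ℂ) • g x := ⟨_, rfl⟩
  have hdc : Continuous d := by rw [hd]; fun_prop
  have hds : HasCompactSupport d := 
    hgs.mono fun x hx hx0 ↦ hx (by simp [hd, hx0])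
  have hdi : Integrable d := hdc.integrable_of_hasCompactSupport hds
  have hd2 : MemLp d 2 := hdc.memLp_of_hasCompactSupport hds
  obtain ⟨hgm, hge⟩ := integral_norm_sq_fourier_eq hgi hg2
  obtain ⟨hdm, hde⟩ := integral_norm_sq_fourier_eq hdi hd2
  have hxc : Continuous fun x : ℝ ↦ x • g x := by fun_prop
  have hxi : Integrable fun x : ℝ ↦ x • g x :=
    hxc.integrable_of_hasCompactSupport (hgs.mono fun x hx hx0 ↦ hx (by simp [hx0]))
  have hder (w : ℝ) : HasDerivAt (𝓕 g) (𝓕 d w) w := by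
    rw [hd]; exact Real.hasDerivAt_fourier hgi hxi w
  refine ⟨𝓕 d, hder, hgm, hdm, ?_⟩
  rw [hge, hde, ← integral_const_mul]
  refine integral_mono hd2.norm.integrable_sq (hg2.norm.integrable_sq.const_mul _) fun x ↦ ?_
  rcases lt_or_ge R (2 * Real.pi * |x|) with h | h
  · simp [hd, hg0 x h]
  · simp only [hd, norm_smul, mul_pow]
    gcongr
    simpa [abs_of_pos Real.pi_pos] using h

open FourierTransform in
/-- **Bernstein's inequality** in `L²` for an integrable function whose Fourier transform is
supported in `[-R, R]`. -/
theorem integral_deriv_sq_le_of_bandlimited {f : ℝ → ℝ} {R : ℝ}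
    (hc : Continuous f) (hi : Integrable f)
    (hsupp : ∀ ξ : ℝ, R < |ξ| → ∫ x : ℝ, (f x : ℂ) * exp (-(I * x * ξ)) = 0) :
    Integrable (fun x ↦ f x ^ 2) ∧ Integrable (fun x ↦ deriv f x ^ 2) ∧
      ∫ x, deriv f x ^ 2 ≤ R ^ 2 * ∫ x, f x ^ 2 := by
  obtain ⟨F, hF⟩ : ∃ F : ℝ → ℂ, F = fun x ↦ (f x : ℂ) := ⟨_, rfl⟩
  have hFc : Continuous F := by rw [hF]; fun_prop
  have hFi : Integrable F := by rw [hF]; exact hi.ofReal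
  obtain ⟨g, hg⟩ : ∃ g : ℝ → ℂ, g = 𝓕 F := ⟨_, rfl⟩
  have hgc : Continuous g := by
    rw [hg]
    exact VectorFourier.fourierIntegral_continuous Real.continuous_fourierChar continuous_inner hFi
  have hg0 (w : ℝ) (hw : R < 2 * Real.pi * |w|) : g w = 0 := by
    rw [hg, Real.fourier_real_eq_integral_exp_smul]
    rw [← hsupp (2 * Real.pi * w) (by rwa [abs_mul, abs_of_pos Real.two_pi_pos])]
    congr 1 with x
    rw [smul_eq_mul, mul_comm, hF]
    congr 2
    push_cast
    ring
  have hgs : HasCompactSupport g := by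
    refine HasCompactSupport.intro (isCompact_closedBall (0 : ℝ) (R / (2 * Real.pi))) fun w hw ↦
      hg0 w ?_
    rw [Metric.mem_closedBall, dist_zero_right, Real.norm_eq_abs, not_le,
      div_lt_iff₀ Real.two_pi_pos] at hw
    linarith
  have hgi : Integrable g := hgc.integrable_of_hasCompactSupport hgs
  have hinv (x : ℝ) : F x = 𝓕 g (-x) := by
    rw [← Real.fourierInv_eq_fourier_neg, hg, hFc.fourierInv_fourier_eq hFi (hg ▸ hgi)]
  obtain ⟨D, hD, hgm, hDm, hle⟩ := integral_norm_deriv_fourier_sq_le hgc hg0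
  have hder (x : ℝ) : HasDerivAt F (-D (-x)) x := by
    have h2 := (hD (-x)).scomp x (hasDerivAt_neg x)
    rw [show F = 𝓕 g ∘ Neg.neg from funext hinv]
    simpa using h2
  have hderf (x : ℝ) : deriv f x ^ 2 = ‖D (-x)‖ ^ 2 := by
    have h1 : HasDerivAt f (reCLM (-D (-x))) x := by
      have := reCLM.hasFDerivAt.comp_hasDerivAt x (hder x)
      rwa [hF] at this
    have h2 := h1.ofReal_comp.unique (hF ▸ hder x)
    have h3 : |reCLM (-D (-x))| = ‖D (-x)‖ := by
      rw [← Real.norm_eq_abs, ← norm_real, h2, norm_neg]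
    rw [h1.deriv, ← h3, sq_abs]
  have hf2 (x : ℝ) : f x ^ 2 = ‖𝓕 g (-x)‖ ^ 2 := by
    rw [← hinv, hF, norm_real, Real.norm_eq_abs, sq_abs]
  simp only [hderf, hf2]
  refine ⟨hgm.norm.integrable_sq.comp_neg, hDm.norm.integrable_sq.comp_neg, ?_⟩
  rwa [integral_neg_eq_self (fun x ↦ ‖D x‖ ^ 2), integral_neg_eq_self (fun x ↦ ‖𝓕 g x‖ ^ 2)]

/-- Pointwise bound for a function vanishing at the left endpoint: the square is controlled by the
integral of any integrable nonnegative majorant of the derivative of the square. -/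
theorem sq_iSup_abs_le_integral {u u' φ : ℝ → ℝ} (hu : ContinuousOn u (Icc (-1) 1))
    (hu0 : u (-1) = 0) (hu' : ∀ y ∈ Ioo (-1 : ℝ) 1, HasDerivAt u (u' y) y)
    (hφ : IntegrableOn φ (Ioo (-1) 1)) (hφ0 : ∀ y, 0 ≤ φ y)
    (hle : ∀ y ∈ Ioo (-1 : ℝ) 1, 2 * u y * u' y ≤ φ y) :
    (⨆ y : Icc (-1 : ℝ) 1, |u y|) ^ 2 ≤ ∫ y in Ioo (-1 : ℝ) 1, φ y := by
  have hφ' : IntegrableOn φ (Icc (-1) 1) := (integrableOn_Icc_iff_integrableOn_Ioo).2 hφ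
  have hnn : 0 ≤ ∫ y in Ioo (-1 : ℝ) 1, φ y := integral_nonneg hφ0
  have key (y : ℝ) (hy : y ∈ Icc (-1 : ℝ) 1) : u y ^ 2 ≤ ∫ y in Ioo (-1 : ℝ) 1, φ y := by
    have hsub : Icc (-1) y ⊆ Icc (-1 : ℝ) 1 := Icc_subset_Icc_right hy.2
    have h := intervalIntegral.sub_le_integral_of_hasDeriv_right_of_le
      (g := fun y ↦ u y ^ 2) (g' := fun y ↦ 2 * u y * u' y) (φ := φ) hy.1
      ((hu.mono hsub).pow 2)
      (fun z hz ↦ by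
        have := (hu' z ⟨hz.1, hz.2.trans_le hy.2⟩).fun_pow 2
        simpa using this.hasDerivWithinAt (s := Ioi z))
      (hφ'.mono_set hsub) (fun z hz ↦ hle z ⟨hz.1, hz.2.trans_le hy.2⟩)
    rw [hu0, intervalIntegral.integral_of_le hy.1] at h
    calc u y ^ 2 ≤ ∫ y in Ioc (-1) y, φ y := by simpa using h
      _ ≤ ∫ y in Icc (-1 : ℝ) 1, φ y := setIntegral_mono_set hφ' (.of_forall hφ0)
          (Ioc_subset_Icc_self.trans hsub).eventuallyLE
      _ = _ := integral_Icc_eq_integral_Ioo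
  have hsup : ⨆ y : Icc (-1 : ℝ) 1, |u y| ≤ √(∫ y in Ioo (-1 : ℝ) 1, φ y) :=
    Real.iSup_le (fun y ↦ Real.abs_le_sqrt (key y y.2)) (Real.sqrt_nonneg _)
  calc _ ≤ √(∫ y in Ioo (-1 : ℝ) 1, φ y) ^ 2 :=
        pow_le_pow_left₀ (Real.iSup_nonneg fun _ ↦ abs_nonneg _) hsup 2
    _ = _ := Real.sq_sqrt hnn

/-- Let `A` and `B` be the integrals over the band of `|a|²` and `|∂ₓ a|²`. If on every horizontal
line the second is at most `R²` times the first and `|∂_y a₂| = |∂ₓ a₁|`, then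
`‖a₂‖²_{L²_x L^∞_y} ≤ 2 R A`. -/
theorem integral_sq_iSup_le {R : ℝ} (hR : 0 < R) {u v w z : ℝ → ℝ → ℝ}
    (hv : ∀ x, ContinuousOn (v x) (Icc (-1) 1)) (hv0 : ∀ x, v x (-1) = 0)
    (hv' : ∀ x, ∀ y ∈ Ioo (-1 : ℝ) 1, HasDerivAt (v x) (-w x y) y)
    (hA : IntegrableOn (fun p : ℝ × ℝ ↦ u p.1 p.2 ^ 2 + v p.1 p.2 ^ 2)
      ((univ : Set ℝ) ×ˢ Ioo (-1 : ℝ) 1))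
    (hB : IntegrableOn (fun p : ℝ × ℝ ↦ w p.1 p.2 ^ 2 + z p.1 p.2 ^ 2)
      ((univ : Set ℝ) ×ˢ Ioo (-1 : ℝ) 1))
    (hline : ∀ y ∈ Ioo (-1 : ℝ) 1,
      ∫ x, w x y ^ 2 + z x y ^ 2 ≤ R ^ 2 * ∫ x, u x y ^ 2 + v x y ^ 2) :
    ∫ x, (⨆ y : Icc (-1 : ℝ) 1, |v x y|) ^ 2 ≤
      2 * R * ∫ x, ∫ y in (-1 : ℝ)..1, u x y ^ 2 + v x y ^ 2 := by
  set ν : Measure ℝ := volume.restrict (Ioo (-1 : ℝ) 1)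
  have hμ : (volume : Measure (ℝ × ℝ)).restrict (univ ×ˢ Ioo (-1 : ℝ) 1) = volume.prod ν := by
    rw [Measure.volume_eq_prod, ← Measure.prod_restrict, Measure.restrict_univ]
  rw [IntegrableOn, hμ] at hA hB
  have hφ := (hA.const_mul R).add (hB.const_mul R⁻¹)
  have hBA : ∫ p, (w p.1 p.2 ^ 2 + z p.1 p.2 ^ 2) ∂(volume.prod ν) ≤
      R ^ 2 * ∫ p, (u p.1 p.2 ^ 2 + v p.1 p.2 ^ 2) ∂(volume.prod ν) := by
    rw [integral_prod_symm _ hA, integral_prod_symm _ hB, ← integral_const_mul]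
    exact setIntegral_mono_on hB.integral_prod_right (hA.integral_prod_right.const_mul _)
      measurableSet_Ioo hline
  have hRHS : ∫ x, ∫ y in (-1 : ℝ)..1, u x y ^ 2 + v x y ^ 2 =
      ∫ p, (u p.1 p.2 ^ 2 + v p.1 p.2 ^ 2) ∂(volume.prod ν) := by
    rw [integral_prod _ hA]
    congr 1 with x
    rw [intervalIntegral.integral_of_le (by norm_num), integral_Ioc_eq_integral_Ioo]
  have hsup : ∀ᵐ x, (⨆ y : Icc (-1 : ℝ) 1, |v x y|) ^ 2 ≤
      ∫ y, (R * (u x y ^ 2 + v x y ^ 2) + R⁻¹ * (w x y ^ 2 + z x y ^ 2)) ∂ν := by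
    filter_upwards [hφ.prod_right_ae] with x hx
    refine sq_iSup_abs_le_integral (hv x) (hv0 x) (hv' x) hx (fun y ↦ by positivity) fun y _ ↦ ?_
    have h1 : 0 ≤ R⁻¹ * (R * v x y + w x y) ^ 2 := by positivity
    have h2 : R⁻¹ * (R * v x y + w x y) ^ 2 =
        R * v x y ^ 2 + 2 * v x y * w x y + R⁻¹ * w x y ^ 2 := by
      field_simp
      ring
    have h3 : 0 ≤ R * u x y ^ 2 := by positivity
    have h4 : 0 ≤ R⁻¹ * z x y ^ 2 := by positivity
    linarith
  rw [hRHS]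
  calc _ ≤ ∫ x, ∫ y, (R * (u x y ^ 2 + v x y ^ 2) + R⁻¹ * (w x y ^ 2 + z x y ^ 2)) ∂ν :=
        integral_mono_of_nonneg (.of_forall fun x ↦ sq_nonneg _) hφ.integral_prod_left hsup
    _ = R * ∫ p, (u p.1 p.2 ^ 2 + v p.1 p.2 ^ 2) ∂(volume.prod ν) +
        R⁻¹ * ∫ p, (w p.1 p.2 ^ 2 + z p.1 p.2 ^ 2) ∂(volume.prod ν) := by
      rw [← integral_const_mul, ← integral_const_mul,
        ← integral_add (hA.const_mul R) (hB.const_mul R⁻¹)]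
      exact (integral_prod _ hφ).symm
    _ ≤ R * ∫ p, (u p.1 p.2 ^ 2 + v p.1 p.2 ^ 2) ∂(volume.prod ν) +
        R⁻¹ * (R ^ 2 * ∫ p, (u p.1 p.2 ^ 2 + v p.1 p.2 ^ 2) ∂(volume.prod ν)) := by gcongr
    _ = _ := by field_simp; ring

/-- Lemma 5.4 of the paper: for a divergence-free vector field
`a = (a₁,a₂)` on the band `ℝ × [-1,1]`, vanishing on the horizontal boundaries,
whose tangential Fourier transform is supported in the dyadic annulus
`{1/100 ≤ 2^{-k}|ξ| ≤ 100}`, the vertical component satisfies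
`‖a₂‖_{L²_x(L^∞_y)} ≤ C 2^{k/2} ‖a‖_{L²}`. -/
theorem block_vertical_component_estimate :
    ∃ C > (0:ℝ), ∀ (k : ℤ) (a₁ a₂ : ℝ → ℝ → ℝ),
      ContDiffOn ℝ 1 (fun p : ℝ × ℝ => (a₁ p.1 p.2, a₂ p.1 p.2))
        ((Set.univ : Set ℝ) ×ˢ Set.Icc (-1:ℝ) 1) →
      IntegrableOn (fun p : ℝ × ℝ => (a₁ p.1 p.2) ^ 2 + (a₂ p.1 p.2) ^ 2)
        ((Set.univ : Set ℝ) ×ˢ Set.Ioo (-1:ℝ) 1) →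
      IntegrableOn (fun p : ℝ × ℝ =>
          (deriv (fun x' => a₁ x' p.2) p.1) ^ 2 + (deriv (fun x' => a₂ x' p.2) p.1) ^ 2)
        ((Set.univ : Set ℝ) ×ˢ Set.Ioo (-1:ℝ) 1) →
      IntegrableOn (fun p : ℝ × ℝ =>
          (deriv (fun y' => a₁ p.1 y') p.2) ^ 2 + (deriv (fun y' => a₂ p.1 y') p.2) ^ 2)
        ((Set.univ : Set ℝ) ×ˢ Set.Ioo (-1:ℝ) 1) →
      (∀ x : ℝ, a₁ x (-1) = 0 ∧ a₁ x 1 = 0 ∧ a₂ x (-1) = 0 ∧ a₂ x 1 = 0) →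
      (∀ x : ℝ, ∀ y ∈ Set.Icc (-1:ℝ) 1,
        deriv (fun x' => a₁ x' y) x + deriv (fun y' => a₂ x y') y = 0) →
      (∀ y ∈ Set.Icc (-1:ℝ) 1,
        Integrable (fun x => a₁ x y) ∧ Integrable (fun x => a₂ x y)) →
      (∀ y ∈ Set.Icc (-1:ℝ) 1, ∀ ξ : ℝ,
        (2:ℝ) ^ (-k) * |ξ| ∉ Set.Icc (1/100 : ℝ) 100 →
        (∫ x : ℝ, (a₁ x y : ℂ) * Complex.exp (-(Complex.I * x * ξ))) = 0 ∧
        (∫ x : ℝ, (a₂ x y : ℂ) * Complex.exp (-(Complex.I * x * ξ))) = 0) →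
      Real.sqrt (∫ x : ℝ, (⨆ y : Set.Icc (-1:ℝ) 1, |a₂ x (y : ℝ)|) ^ 2) ≤
        C * (2:ℝ) ^ ((k:ℝ)/2) *
          Real.sqrt (∫ x : ℝ, ∫ y in (-1:ℝ)..1,
            (a₁ x y) ^ 2 + (a₂ x y) ^ 2) := by
  refine ⟨√200, by positivity, fun k a₁ a₂ hC hA hB _ h0 hdiv hint hsupp ↦ ?_⟩
  set R : ℝ := 100 * (2 : ℝ) ^ k with hRdef
  have hR : 0 < R := by positivity
  have hband (y : ℝ) (hy : y ∈ Icc (-1 : ℝ) 1) (ξ : ℝ) (hξ : R < |ξ|) := hsupp y hy ξ <| by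
    refine fun h ↦ hξ.not_ge ?_
    have h2 : (2 : ℝ) ^ k * ((2 : ℝ) ^ (-k) * |ξ|) ≤ (2 : ℝ) ^ k * 100 := by gcongr; exact h.2
    rw [← mul_assoc, ← zpow_add₀ two_ne_zero, add_neg_cancel, zpow_zero, one_mul] at h2
    linarith
  have hC₁ : ContDiffOn ℝ 1 (fun p : ℝ × ℝ ↦ a₁ p.1 p.2) (univ ×ˢ Icc (-1 : ℝ) 1) := hC.fst
  have hC₂ : ContDiffOn ℝ 1 (fun p : ℝ × ℝ ↦ a₂ p.1 p.2) (univ ×ˢ Icc (-1 : ℝ) 1) := hC.snd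
  have hcx {b : ℝ → ℝ → ℝ}
      (hb : ContDiffOn ℝ 1 (fun p : ℝ × ℝ ↦ b p.1 p.2) (univ ×ˢ Icc (-1 : ℝ) 1))
      (y : ℝ) (hy : y ∈ Icc (-1 : ℝ) 1) : Continuous fun x ↦ b x y :=
    hb.continuousOn.comp_continuous (by fun_prop : Continuous fun x : ℝ ↦ (x, y))
      fun x ↦ ⟨mem_univ _, hy⟩
  have hmain := integral_sq_iSup_le hR (u := a₁) (v := a₂)
    (w := fun x y ↦ deriv (fun x' ↦ a₁ x' y) x) (z := fun x y ↦ deriv (fun x' ↦ a₂ x' y) x)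
    (fun x ↦ hC₂.continuousOn.comp (by fun_prop : ContinuousOn (fun y : ℝ ↦ (x, y)) _)
      fun y hy ↦ ⟨mem_univ _, hy⟩)
    (fun x ↦ (h0 x).2.2.1)
    (fun x y hy ↦ by
      have hnhds : (univ : Set ℝ) ×ˢ Icc (-1 : ℝ) 1 ∈ nhds (x, y) :=
        prod_mem_nhds Filter.univ_mem (Icc_mem_nhds hy.1 hy.2)
      have hd : DifferentiableAt ℝ (fun p : ℝ × ℝ ↦ a₂ p.1 p.2) (x, y) :=
        (hC₂.contDiffAt hnhds).differentiableAt one_ne_zero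
      have hd' : DifferentiableAt ℝ (a₂ x) y :=
        hd.comp y (by fun_prop : DifferentiableAt ℝ (fun y : ℝ ↦ (x, y)) y)
      have he := hdiv x y (Ioo_subset_Icc_self hy)
      rw [← eq_neg_of_add_eq_zero_right he]
      exact hd'.hasDerivAt)
    hA hB
    (fun y hy ↦ by
      have hy' := Ioo_subset_Icc_self hy
      obtain ⟨hu, hw, h1⟩ := integral_deriv_sq_le_of_bandlimited (hcx hC₁ y hy') (hint y hy').1
        fun ξ hξ ↦ (hband y hy' ξ hξ).1
      obtain ⟨hv, hz, h2⟩ := integral_deriv_sq_le_of_bandlimited (hcx hC₂ y hy') (hint y hy').2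
        fun ξ hξ ↦ (hband y hy' ξ hξ).2
      rw [integral_add hu hv, integral_add hw hz]
      linarith)
  have hpow : (2 : ℝ) ^ ((k : ℝ) / 2) = √((2 : ℝ) ^ k) := by
    rw [Real.sqrt_eq_rpow, ← Real.rpow_intCast, ← Real.rpow_mul zero_le_two]
    ring_nf
  rw [hpow, ← Real.sqrt_mul (by norm_num), ← Real.sqrt_mul (by positivity)]
  refine Real.sqrt_le_sqrt (hmain.trans_eq ?_)
  rw [hRdef]
  ring
end

section
/- There exists a constant C > 0 with the following property. Let k ∈ ℤ and let a : ℝ × [-1,1] → ℝ be continuously differentiable with a and its first partial derivatives square-integrable on ℝ × (-1,1), with a(x,-1) = a(x,1) = 0 for all x, and such that for every y ∈ [-1,1] the function x ↦ a(x,y) is integrable and its Fourier transform ξ ↦ ∫_ℝ a(x,y) e^{-i x ξ} dx vanishes for every ξ with 2^{-k}|ξ| ∉ [1/100, 100]. Then 2^{k/2} (∫_ℝ (sup_{y∈[-1,1]} |a(x,y)|)² dx)^{1/2} ≤ C · (∫_ℝ ∫_{-1}^{1} (|∂_x a(x,y)|² + |∂_y a(x,y)|²) dy dx)^{1/2}.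 -/
open MeasureTheory Set Complex
open scoped FourierTransform

/-- The Plancherel identity for a continuous integrable function with integrable Fourier
transform. -/
theorem integral_norm_sq_fourier_eq_s5 {f : ℝ → ℂ} (hc : Continuous f) (hf : Integrable f)
    (h'f : Integrable (𝓕 f)) : ∫ ξ, ‖𝓕 f ξ‖ ^ 2 = ∫ x, ‖f x‖ ^ 2 := by
  have h := VectorFourier.integral_sesq_fourierIntegral_eq_neg_flip (μ := volume) (ν := volume)
    (L := innerₗ ℝ) (innerSL ℂ : ℂ →L⋆[ℂ] ℂ →L[ℂ] ℂ) Real.continuous_fourierChar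
    continuous_inner hf h'f
  have hinv : VectorFourier.fourierIntegral Real.fourierChar volume (-(innerₗ ℝ).flip) (𝓕 f)
      = f := by
    conv_rhs => rw [← hc.fourierInv_fourier_eq hf h'f]
    ext x
    rw [Real.fourierInv_eq]
    simp [VectorFourier.fourierIntegral]
  rw [hinv] at h
  have hinner : ∀ z : ℂ, innerSL ℂ z z = ((‖z‖ ^ 2 : ℝ) : ℂ) := fun z ↦ by simp
  change ∫ ξ, innerSL ℂ (𝓕 f ξ) (𝓕 f ξ) = _ at h
  simp_rw [hinner] at h
  rw [integral_complex_ofReal, integral_complex_ofReal] at h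
  exact_mod_cast h

theorem continuous_fourier_of_integrable {f : ℝ → ℂ} (hf : Integrable f) : Continuous (𝓕 f) :=
  VectorFourier.fourierIntegral_continuous Real.continuous_fourierChar (innerSL ℝ).continuous₂ hf

/-- The Fourier transform turns a finite difference into multiplication by `𝐞 (h w) - 1`. -/
theorem fourier_comp_add_sub {f : ℝ → ℂ} (hf : Integrable f) (h w : ℝ) :
    𝓕 (fun x ↦ f (x + h) - f x) w = ((Real.fourierChar (h * w) : ℂ) - 1) * 𝓕 f w := by
  have htr : 𝓕 (fun x ↦ f (x + h)) w = (Real.fourierChar (h * w) : ℂ) * 𝓕 f w := by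
    have := congrFun (Fourier.fourierIntegral_comp_add_right Real.fourierChar volume f h) w
    simpa [Fourier.fourierIntegral_def, Real.fourier_real_eq, Circle.smul_def,
      Function.comp_def] using this
  have hsub : 𝓕 (fun x ↦ f (x + h) - f x) w = 𝓕 (fun x ↦ f (x + h)) w - 𝓕 f w := by
    simp only [Real.fourier_eq, smul_sub]
    exact integral_sub ((Real.fourierIntegral_convergent_iff w).2 (hf.comp_add_right h))
      ((Real.fourierIntegral_convergent_iff w).2 hf)
  rw [hsub, htr]
  ring

/-- Cauchy-Schwarz against the constant function on an interval. -/
theorem sq_intervalIntegral_le {u : ℝ → ℝ} (hu : Continuous u) {h : ℝ} (hh : 0 < h) :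
    (∫ t in (0:ℝ)..h, u t) ^ 2 ≤ h * ∫ t in (0:ℝ)..h, u t ^ 2 := by
  set m := ∫ t in (0:ℝ)..h, u t with hm
  have hpos : 0 ≤ ∫ t in (0:ℝ)..h, (h * u t - m) ^ 2 :=
    intervalIntegral.integral_nonneg hh.le fun t _ ↦ sq_nonneg _
  have hexp : ∫ t in (0:ℝ)..h, (h * u t - m) ^ 2
      = h ^ 2 * (∫ t in (0:ℝ)..h, u t ^ 2) - h * m ^ 2 := by
    have : ∀ t, (h * u t - m) ^ 2 = h ^ 2 * u t ^ 2 - 2 * h * m * u t + m ^ 2 := fun t ↦ by ring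
    simp_rw [this]
    rw [intervalIntegral.integral_add (Continuous.intervalIntegrable (by fun_prop) _ _)
        (Continuous.intervalIntegrable (by fun_prop) _ _),
      intervalIntegral.integral_sub (Continuous.intervalIntegrable (by fun_prop) _ _)
        (Continuous.intervalIntegrable (by fun_prop) _ _),
      intervalIntegral.integral_const_mul, intervalIntegral.integral_const_mul, ← hm]
    simp only [intervalIntegral.integral_const, smul_eq_mul]
    ring
  rw [hexp] at hpos
  have : 0 ≤ h * (h * (∫ t in (0:ℝ)..h, u t ^ 2) - m ^ 2) := by linarith
  linarith [nonneg_of_mul_nonneg_right this hh]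

/-- The `L²` norm of a finite difference is at most the step times that of the derivative. -/
theorem integral_sq_comp_add_sub_le {f : ℝ → ℝ} (hf : ContDiff ℝ 1 f)
    (hd : Integrable fun x ↦ deriv f x ^ 2) {h : ℝ} (hh : 0 < h) :
    ∫ x, (f (x + h) - f x) ^ 2 ≤ h ^ 2 * ∫ x, deriv f x ^ 2 := by
  have hdc : Continuous (deriv f) := hf.continuous_deriv le_rfl
  have hint : Integrable (fun p : ℝ × ℝ ↦ deriv f (p.1 + p.2) ^ 2)
      (volume.prod (volume.restrict (Ioc 0 h))) := by
    rw [integrable_prod_iff' (Continuous.aestronglyMeasurable (by fun_prop))]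
    refine ⟨.of_forall fun t ↦ hd.comp_add_right t, ?_⟩
    have : ∀ t, ∫ x, ‖deriv f (x + t) ^ 2‖ = ∫ x, ‖deriv f x ^ 2‖ := fun t ↦
      integral_add_right_eq_self (fun x ↦ ‖deriv f x ^ 2‖) t
    simp only [this]
    exact integrable_const _
  have hpt : ∀ x, (f (x + h) - f x) ^ 2 ≤ h * ∫ t in Ioc 0 h, deriv f (x + t) ^ 2 := by
    intro x
    have hftc : ∫ t in (0:ℝ)..h, deriv f (x + t) = f (x + h) - f x := by
      rw [intervalIntegral.integral_comp_add_left, add_zero]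
      exact intervalIntegral.integral_deriv_eq_sub
        (fun y _ ↦ (hf.differentiable one_ne_zero).differentiableAt) (hdc.intervalIntegrable _ _)
    rw [← hftc, ← intervalIntegral.integral_of_le hh.le]
    exact sq_intervalIntegral_le (by fun_prop) hh
  calc ∫ x, (f (x + h) - f x) ^ 2
      ≤ ∫ x, h * ∫ t in Ioc 0 h, deriv f (x + t) ^ 2 :=
        integral_mono_of_nonneg (.of_forall fun x ↦ sq_nonneg _)
          (hint.integral_prod_left.const_mul h) (.of_forall hpt)
    _ = h * ∫ t in Ioc 0 h, ∫ x, deriv f (x + t) ^ 2 := by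
        rw [integral_const_mul, integral_integral_swap hint]
    _ = h ^ 2 * ∫ x, deriv f x ^ 2 := by
        have : ∀ t, ∫ x, deriv f (x + t) ^ 2 = ∫ x, deriv f x ^ 2 := fun t ↦
          integral_add_right_eq_self (fun x ↦ deriv f x ^ 2) t
        simp only [this, setIntegral_const, smul_eq_mul]
        simp [hh.le]
        ring

/-- Reverse Bernstein inequality: if the frequencies of `f` lie in an annulus of size `K`, then
`K ‖f‖_{L²}` is controlled by the `L²` norm of its derivative. -/
theorem sq_mul_integral_sq_le_of_fourier_support {f : ℝ → ℝ} {K : ℝ} (hK : 0 < K)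
    (hf : ContDiff ℝ 1 f) (hfi : Integrable f) (hd : Integrable fun x ↦ deriv f x ^ 2)
    (hsupp : ∀ w : ℝ, 𝓕 (fun x ↦ (f x : ℂ)) w ≠ 0 →
      K / 100 ≤ 2 * Real.pi * |w| ∧ 2 * Real.pi * |w| ≤ 100 * K) :
    K ^ 2 * ∫ x, f x ^ 2 ≤ 25000 * ∫ x, deriv f x ^ 2 := by
  have hπ := Real.pi_pos
  set F : ℝ → ℂ := fun x ↦ (f x : ℂ) with hF
  set h : ℝ := Real.pi / (100 * K) with hh
  have hhK : h * K = Real.pi / 100 := by rw [hh]; field_simp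
  have hhpos : 0 < h := by positivity
  set D : ℝ → ℂ := fun x ↦ F (x + h) - F x with hD
  have hFi : Integrable F := hfi.ofReal
  have hFc : Continuous F := continuous_ofReal.comp hf.continuous
  have hDi : Integrable D := (hFi.comp_add_right h).sub hFi
  have hDc : Continuous D := by fun_prop
  have hFs : HasCompactSupport (𝓕 F) := by
    refine HasCompactSupport.intro (isCompact_closedBall (0:ℝ) (100 * K / (2 * Real.pi))) ?_
    intro w hw
    by_contra hne
    apply hw
    rw [mem_closedBall_zero_iff, Real.norm_eq_abs, le_div_iff₀ (by positivity)]
    linarith [(hsupp w hne).2]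
  have hDF : ∀ w, 𝓕 D w = ((Real.fourierChar (h * w) : ℂ) - 1) * 𝓕 F w :=
    fun w ↦ fourier_comp_add_sub hFi h w
  have hDs : HasCompactSupport (𝓕 D) := by
    rw [funext hDF]
    exact hFs.mul_left
  have hFFc := continuous_fourier_of_integrable hFi
  have hDFc := continuous_fourier_of_integrable hDi
  have hlow : ∀ w, ‖𝓕 F w‖ ^ 2 ≤ 5000 ^ 2 * ‖𝓕 D w‖ ^ 2 := by
    intro w
    by_cases hw : 𝓕 F w = 0
    · simp [hw]
    obtain ⟨h1, h2⟩ := hsupp w hw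
    have hchar : ‖(Real.fourierChar (h * w) : ℂ) - 1‖ = 2 * |Real.sin (Real.pi * (h * w))| := by
      rw [Real.fourierChar_apply, mul_comm _ I, norm_exp_I_mul_ofReal_sub_one, norm_mul,
        Real.norm_eq_abs, Real.norm_eq_abs, abs_two]
      congr 3
      ring
    have habs : |Real.pi * (h * w)| = h * (2 * Real.pi * |w|) / 2 := by
      rw [abs_mul, abs_mul, abs_of_pos hπ, abs_of_pos hhpos]
      ring
    have hup : |Real.pi * (h * w)| ≤ Real.pi / 2 := by
      rw [habs]
      nlinarith [mul_le_mul_of_nonneg_left h2 hhpos.le]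
    have hlo : Real.pi / 20000 ≤ |Real.pi * (h * w)| := by
      rw [habs]
      nlinarith [mul_le_mul_of_nonneg_left h1 hhpos.le]
    have hsin : 1 / 5000 ≤ ‖(Real.fourierChar (h * w) : ℂ) - 1‖ := by
      rw [hchar]
      have h3 := Real.mul_abs_le_abs_sin hup
      have h4 : 2 / Real.pi * (Real.pi / 20000) ≤ 2 / Real.pi * |Real.pi * (h * w)| := by gcongr
      have h5 : 2 / Real.pi * (Real.pi / 20000) = 1 / 10000 := by field_simp; norm_num
      linarith
    have : ‖𝓕 F w‖ ≤ 5000 * ‖𝓕 D w‖ := by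
      rw [hDF, norm_mul]
      nlinarith [mul_le_mul_of_nonneg_right hsin (norm_nonneg (𝓕 F w))]
    rw [← mul_pow]
    gcongr
  have hDsq : Integrable fun w ↦ 5000 ^ 2 * ‖𝓕 D w‖ ^ 2 := by
    refine Integrable.const_mul (Continuous.integrable_of_hasCompactSupport (by fun_prop) ?_) _
    exact hDs.comp_left (g := fun z : ℂ ↦ ‖z‖ ^ 2) (by simp)
  have hmono : ∫ w, ‖𝓕 F w‖ ^ 2 ≤ 5000 ^ 2 * ∫ w, ‖𝓕 D w‖ ^ 2 := by
    rw [← integral_const_mul]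
    exact integral_mono_of_nonneg (.of_forall fun w ↦ by positivity) hDsq (.of_forall hlow)
  rw [integral_norm_sq_fourier_eq_s5 hFc hFi (hFFc.integrable_of_hasCompactSupport hFs),
    integral_norm_sq_fourier_eq_s5 hDc hDi (hDFc.integrable_of_hasCompactSupport hDs)] at hmono
  have hFn : ∀ x, ‖F x‖ ^ 2 = f x ^ 2 := fun x ↦ by simp [hF]
  have hDn : ∀ x, ‖D x‖ ^ 2 = (f (x + h) - f x) ^ 2 := fun x ↦ by
    simp only [hD, hF]
    rw [← ofReal_sub, norm_real, Real.norm_eq_abs, sq_abs]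
  simp_rw [hFn, hDn] at hmono
  have hdiff := integral_sq_comp_add_sub_le hf hd hhpos
  have hd0 : 0 ≤ ∫ x, deriv f x ^ 2 := integral_nonneg fun x ↦ sq_nonneg _
  have hπ2 : Real.pi ^ 2 ≤ 10 := by nlinarith [Real.pi_lt_d2]
  calc K ^ 2 * ∫ x, f x ^ 2
      ≤ K ^ 2 * (5000 ^ 2 * (h ^ 2 * ∫ x, deriv f x ^ 2)) := by gcongr; linarith
    _ = 5000 ^ 2 * (h * K) ^ 2 * ∫ x, deriv f x ^ 2 := by ring
    _ ≤ 25000 * ∫ x, deriv f x ^ 2 := by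
        rw [hhK]
        gcongr
        linarith

/-- One-dimensional Agmon inequality for a function vanishing at the left endpoint. -/
theorem mul_sq_iSup_abs_le {g : ℝ → ℝ} {a b K : ℝ} (hab : a < b) (hK : 0 < K)
    (hg : ContDiffOn ℝ 1 g (Icc a b)) (h0 : g a = 0) :
    K * (⨆ y : Icc a b, |g y|) ^ 2 ≤ ∫ y in a..b, (K ^ 2 * g y ^ 2 + deriv g y ^ 2) := by
  set g' := derivWithin g (Icc a b) with hg'
  have hgc : ContinuousOn g (Icc a b) := hg.continuousOn
  have hg'c : ContinuousOn g' (Icc a b) :=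
    hg.continuousOn_derivWithin (uniqueDiffOn_Icc hab) le_rfl
  have hderiv : ∀ y ∈ Ioo a b, HasDerivAt g (g' y) y := fun y hy ↦
    ((hg.differentiableOn one_ne_zero y (Ioo_subset_Icc_self hy)).hasDerivWithinAt).hasDerivAt
      (Icc_mem_nhds hy.1 hy.2)
  have hcongr : ∫ y in a..b, (K ^ 2 * g y ^ 2 + deriv g y ^ 2)
      = ∫ y in a..b, (K ^ 2 * g y ^ 2 + g' y ^ 2) := by
    rw [intervalIntegral.integral_of_le hab.le, intervalIntegral.integral_of_le hab.le,
      integral_Ioc_eq_integral_Ioo, integral_Ioc_eq_integral_Ioo]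
    exact setIntegral_congr_fun measurableSet_Ioo fun y hy ↦ by
      simp only [(hderiv y hy).deriv]
  set B := ∫ y in a..b, (K ^ 2 * g y ^ 2 + g' y ^ 2) with hB
  have hEc : ContinuousOn (fun y ↦ K ^ 2 * g y ^ 2 + g' y ^ 2) (Icc a b) := by fun_prop
  have hpt : ∀ y ∈ Icc a b, K * g y ^ 2 ≤ B := by
    intro y hy
    have hsub : Icc a y ⊆ Icc a b := Icc_subset_Icc_right hy.2
    have hftc : ∫ t in a..y, K * (2 * g t * g' t) = K * g y ^ 2 - K * g a ^ 2 := by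
      refine intervalIntegral.integral_eq_sub_of_hasDerivAt_of_le (f := fun t ↦ K * g t ^ 2)
        hy.1 ?_ ?_ ?_
      · have := hgc.mono hsub
        fun_prop
      · intro t ht
        have := ((hderiv t ⟨ht.1, ht.2.trans_le hy.2⟩).pow 2).const_mul K
        convert! this using 1
        norm_num
      · apply ContinuousOn.intervalIntegrable_of_Icc hy.1
        have := hgc.mono hsub
        have := hg'c.mono hsub
        fun_prop
    rw [h0] at hftc
    calc K * g y ^ 2 = ∫ t in a..y, K * (2 * g t * g' t) := by rw [hftc]; ring
      _ ≤ ∫ t in a..y, (K ^ 2 * g t ^ 2 + g' t ^ 2) := by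
          refine intervalIntegral.integral_mono_on hy.1 ?_
            ((hEc.mono hsub).intervalIntegrable_of_Icc hy.1) fun t _ ↦ by
              nlinarith [sq_nonneg (K * g t - g' t)]
          apply ContinuousOn.intervalIntegrable_of_Icc hy.1
          have := hgc.mono hsub
          have := hg'c.mono hsub
          fun_prop
      _ ≤ B := intervalIntegral.integral_mono_interval le_rfl hy.1 hy.2
          (.of_forall fun t ↦ by positivity) (hEc.intervalIntegrable_of_Icc hab.le)
  rw [hcongr]
  have hne : Nonempty (Icc a b) := ⟨⟨a, left_mem_Icc.2 hab.le⟩⟩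
  have hsup : (⨆ y : Icc a b, |g y|) ≤ √(B / K) := ciSup_le fun y ↦ by
    apply Real.le_sqrt_of_sq_le
    rw [sq_abs, le_div_iff₀ hK]
    linarith [hpt y y.2]
  have hB0 : 0 ≤ B := le_trans (by positivity) (hpt a (left_mem_Icc.2 hab.le))
  have hsq : (⨆ y : Icc a b, |g y|) ^ 2 ≤ B / K := by
    rw [← Real.sq_sqrt (show 0 ≤ B / K by positivity)]
    gcongr
    exact Real.iSup_nonneg fun y ↦ abs_nonneg _
  rwa [le_div_iff₀ hK, mul_comm] at hsq

/-- the per-block inequality (5.23) inside Lemma 5.3 of the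
paper: for a function `a` on the band `ℝ × [-1,1]`, vanishing on the horizontal
boundaries, whose tangential Fourier transform is supported in the dyadic
annulus `{1/100 ≤ 2^{-k}|ξ| ≤ 100}`, one has
`2^{k/2} ‖a‖_{L²_x(L^∞_y)} ≤ C ‖∇a‖_{L²}`. -/
theorem block_Linfty_estimate :
    ∃ C > (0:ℝ), ∀ (k : ℤ) (a : ℝ → ℝ → ℝ),
      ContDiffOn ℝ 1 (fun p : ℝ × ℝ => a p.1 p.2)
        ((Set.univ : Set ℝ) ×ˢ Set.Icc (-1:ℝ) 1) →
      IntegrableOn (fun p : ℝ × ℝ => (a p.1 p.2) ^ 2)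
        ((Set.univ : Set ℝ) ×ˢ Set.Ioo (-1:ℝ) 1) →
      IntegrableOn (fun p : ℝ × ℝ => (deriv (fun x' => a x' p.2) p.1) ^ 2)
        ((Set.univ : Set ℝ) ×ˢ Set.Ioo (-1:ℝ) 1) →
      IntegrableOn (fun p : ℝ × ℝ => (deriv (fun y' => a p.1 y') p.2) ^ 2)
        ((Set.univ : Set ℝ) ×ˢ Set.Ioo (-1:ℝ) 1) →
      (∀ x : ℝ, a x (-1) = 0 ∧ a x 1 = 0) →
      (∀ y ∈ Set.Icc (-1:ℝ) 1, Integrable (fun x => a x y)) →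
      (∀ y ∈ Set.Icc (-1:ℝ) 1, ∀ ξ : ℝ,
        (2:ℝ) ^ (-k) * |ξ| ∉ Set.Icc (1/100 : ℝ) 100 →
        (∫ x : ℝ, (a x y : ℂ) * Complex.exp (-(Complex.I * x * ξ))) = 0) →
      (2:ℝ) ^ ((k:ℝ)/2) *
          Real.sqrt (∫ x : ℝ, (⨆ y : Set.Icc (-1:ℝ) 1, |a x (y : ℝ)|) ^ 2) ≤
        C * Real.sqrt (∫ x : ℝ, ∫ y in (-1:ℝ)..1,
          (deriv (fun x' => a x' y) x) ^ 2 + (deriv (fun y' => a x y') y) ^ 2) := by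
  refine ⟨200, by norm_num, ?_⟩
  intro k a hC hA hX hY hbd hint hsupp
  set K : ℝ := (2:ℝ) ^ k with hKdef
  have hK : 0 < K := by positivity
  set ν : Measure ℝ := volume.restrict (Ioo (-1:ℝ) 1) with hν
  have hμ : (volume : Measure (ℝ × ℝ)).restrict ((univ : Set ℝ) ×ˢ Ioo (-1:ℝ) 1)
      = volume.prod ν := by
    rw [Measure.volume_eq_prod, ← Measure.prod_restrict, Measure.restrict_univ]
  rw [IntegrableOn, hμ] at hA hX hY
  have hxc : ∀ y ∈ Icc (-1:ℝ) 1, ContDiff ℝ 1 fun x ↦ a x y := by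
    intro y hy
    rw [← contDiffOn_univ]
    exact hC.comp (f := fun x : ℝ ↦ (x, y)) (by fun_prop) fun x _ ↦ ⟨mem_univ _, hy⟩
  have hyc : ∀ x, ContDiffOn ℝ 1 (fun y ↦ a x y) (Icc (-1) 1) := fun x ↦
    hC.comp (f := fun y : ℝ ↦ (x, y)) (by fun_prop) fun y hy ↦ ⟨mem_univ _, hy⟩
  have hBern : ∀ y ∈ Icc (-1:ℝ) 1, Integrable (fun x ↦ deriv (fun x' ↦ a x' y) x ^ 2) →
      K ^ 2 * ∫ x, a x y ^ 2 ≤ 25000 * ∫ x, deriv (fun x' ↦ a x' y) x ^ 2 := by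
    intro y hy hd
    refine sq_mul_integral_sq_le_of_fourier_support hK (hxc y hy) (hint y hy) hd fun w hw ↦ ?_
    by_contra hcon
    apply hw
    rw [Real.fourier_real_eq_integral_exp_smul, ← hsupp y hy (2 * Real.pi * w) ?_]
    · refine integral_congr_ae (.of_forall fun x ↦ ?_)
      simp only [smul_eq_mul]
      rw [mul_comm]
      congr 2
      push_cast
      ring
    · intro hmem
      apply hcon
      rw [zpow_neg, ← hKdef, abs_mul, abs_of_pos Real.two_pi_pos, mem_Icc,
        inv_mul_eq_div, le_div_iff₀ hK, div_le_iff₀ hK] at hmem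
      exact ⟨by linarith [hmem.1], hmem.2⟩
  have hAX : K ^ 2 * ∫ x, ∫ y, a x y ^ 2 ∂ν ≤
      25000 * ∫ x, ∫ y, deriv (fun x' ↦ a x' y) x ^ 2 ∂ν := by
    rw [integral_integral_swap (f := fun x y ↦ a x y ^ 2) hA,
      integral_integral_swap (f := fun x y ↦ deriv (fun x' ↦ a x' y) x ^ 2) hX,
      ← integral_const_mul, ← integral_const_mul]
    refine integral_mono_ae (hA.integral_prod_right.const_mul _)
      (hX.integral_prod_right.const_mul _) ?_
    filter_upwards [hX.prod_left_ae, ae_restrict_mem measurableSet_Ioo] with y hy hy'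
    exact hBern y (Ioo_subset_Icc_self hy') hy
  have hii : ∀ u : ℝ → ℝ, ∫ y in (-1:ℝ)..1, u y = ∫ y, u y ∂ν := fun u ↦ by
    rw [intervalIntegral.integral_of_le (by norm_num), integral_Ioc_eq_integral_Ioo]
  have hsum : ∀ c : ℝ, ∀ u v : ℝ × ℝ → ℝ, Integrable u (volume.prod ν) →
      Integrable v (volume.prod ν) → ∫ x, ∫ y, (c * u (x, y) + v (x, y)) ∂ν
        = c * (∫ x, ∫ y, u (x, y) ∂ν) + ∫ x, ∫ y, v (x, y) ∂ν := by
    intro c u v hu hv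
    rw [← integral_prod (fun p ↦ c * u p + v p) ((hu.const_mul c).add hv), ← integral_prod _ hu,
      ← integral_prod _ hv, integral_add (hu.const_mul c) hv, integral_const_mul]
  have hsup : K * ∫ x, (⨆ y : Icc (-1:ℝ) 1, |a x y|) ^ 2
      ≤ K ^ 2 * (∫ x, ∫ y, a x y ^ 2 ∂ν) + ∫ x, ∫ y, deriv (fun y' ↦ a x y') y ^ 2 ∂ν := by
    rw [← hsum (K ^ 2) _ _ hA hY, ← integral_const_mul]
    refine integral_mono_of_nonneg (.of_forall fun x ↦ by positivity)
      ((hA.const_mul (K ^ 2)).add hY).integral_prod_left (.of_forall fun x ↦ ?_)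
    simp only [← hii]
    exact mul_sq_iSup_abs_le (by norm_num) hK (hyc x) (hbd x).1
  have hR := hsum 1 _ _ hX hY
  simp only [one_mul] at hR
  simp only [hii]
  rw [hR]
  set X := ∫ x, ∫ y, deriv (fun x' ↦ a x' y) x ^ 2 ∂ν
  set Y := ∫ x, ∫ y, deriv (fun y' ↦ a x y') y ^ 2 ∂ν
  have hX0 : 0 ≤ X := integral_nonneg fun x ↦ integral_nonneg fun y ↦ sq_nonneg _
  have hY0 : 0 ≤ Y := integral_nonneg fun x ↦ integral_nonneg fun y ↦ sq_nonneg _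
  have hpow : (2:ℝ) ^ ((k:ℝ) / 2) = √K := by
    rw [Real.sqrt_eq_rpow, hKdef, ← Real.rpow_intCast, ← Real.rpow_mul zero_le_two]
    ring_nf
  rw [hpow, ← Real.sqrt_mul hK.le, Real.sqrt_le_left (by positivity), mul_pow,
    Real.sq_sqrt (by positivity)]
  linarith
end
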